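/- arXiv:1603.01799 — 3 statements merged into one kernel-verified Lean document; each statement's English description precedes it below -/
import Mathlib

section
/- There is a universal constant C such that the following holds. For m ≥ 1 let n = m², partition {1,…,n} into m consecutive blocks J_1,…,J_m of size m, and let B^{(m)} = { x ∈ {−1,1}^n : Σ_{i=1}^m ( m^{−1/2} Σ_{j∈J_i} x_j )² ≤ m }. Then for every half-space A ⊆ {−1,1}^n, Cov(1_{B^{(m)}}, 1_A) ≤ C m^{−1/200}. -/
open Real

/-- The `±1` value of a boolean coordinate. -/
noncomputable def bval (b : Bool) : ℝ := if b then 1 else -1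

/-- Expectation with respect to the uniform measure on the discrete cube `{-1,1}^n`. -/
noncomputable def bExp (n : ℕ) (f : (Fin n → Bool) → ℝ) : ℝ :=
  (∑ x : Fin n → Bool, f x) / 2 ^ n

/-- Covariance on the discrete cube. -/
noncomputable def bCov (n : ℕ) (f g : (Fin n → Bool) → ℝ) : ℝ :=
  bExp n (fun x => (f x - bExp n f) * (g x - bExp n g))

/-- Variance on the discrete cube. -/
noncomputable def bVar (n : ℕ) (f : (Fin n → Bool) → ℝ) : ℝ := bCov n f f

/-- The character `χ_S(x) = ∏_{i ∈ S} x_i`. -/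
noncomputable def chi (n : ℕ) (S : Finset (Fin n)) (x : Fin n → Bool) : ℝ :=
  ∏ i ∈ S, bval (x i)

/-- The Fourier coefficient `f̂(S) = E[f χ_S]`. -/
noncomputable def fourierCoef (n : ℕ) (f : (Fin n → Bool) → ℝ) (S : Finset (Fin n)) : ℝ :=
  bExp n (fun x => f x * chi n S x)

/-- The Bonami--Beckner semigroup `P_t f = Σ_S e^{-t|S|} f̂(S) χ_S`. -/
noncomputable def bP (n : ℕ) (t : ℝ) (f : (Fin n → Bool) → ℝ) : (Fin n → Bool) → ℝ :=
  fun x => ∑ S : Finset (Fin n), Real.exp (-t * S.card) * fourierCoef n f S * chi n S x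

/-- A half-space `{x : ⟨a, x⟩ ≤ b}` in `{-1,1}^n`. -/
def IsHalfspaceB {n : ℕ} (A : Set (Fin n → Bool)) : Prop :=
  ∃ (a : Fin n → ℝ) (b : ℝ), A = {x | ∑ i, a i * bval (x i) ≤ b}

/-- `M(g)`: the supremum over half-spaces `A` of `Cov(g, 1_A)`. -/
noncomputable def Mb (n : ℕ) (g : (Fin n → Bool) → ℝ) : ℝ :=
  ⨆ A : {A : Set (Fin n → Bool) // IsHalfspaceB A}, bCov n g (Set.indicator A.1 1)

/-- `z ⊘ x`: coordinates where `z` is `none` (i.e. 0) are filled in by `x`. -/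
def oslash {n : ℕ} (z : Fin n → Option Bool) (x : Fin n → Bool) : Fin n → Bool :=
  fun i => (z i).getD (x i)

/-- The restriction `f_z(x) = f(z ⊘ x)`. -/
noncomputable def restrictF {n : ℕ} (f : (Fin n → Bool) → ℝ) (z : Fin n → Option Bool) :
    (Fin n → Bool) → ℝ := fun x => f (oslash z x)

/-- The `μ_s`-probability of the restriction pattern `z ∈ {-1,0,1}^n`: each coordinate is
independently `0` (here `none`) with probability `e^{-s}`, and `±1` with probability
`(1-e^{-s})/2` each. -/
noncomputable def muWeight (n : ℕ) (s : ℝ) (z : Fin n → Option Bool) : ℝ :=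
  ∏ i, if z i = none then Real.exp (-s) else (1 - Real.exp (-s)) / 2

/-- Expectation over a random restriction `Z ∼ μ_s`. -/
noncomputable def restExp (n : ℕ) (s : ℝ) (g : (Fin n → Option Bool) → ℝ) : ℝ :=
  ∑ z : Fin n → Option Bool, muWeight n s z * g z

/-- `w₁(f) = Σ_i f̂({i})²`. -/
noncomputable def w1b (n : ℕ) (f : (Fin n → Bool) → ℝ) : ℝ :=
  ∑ i : Fin n, (fourierCoef n f {i}) ^ 2

/-- The boolean version of the ball example: `n = m²`, the coordinates are split into `m`
consecutive blocks `J_i = {j : j / m = i}` of size `m`, and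
`B^{(m)} = {x : Σ_i (m^{-1/2} Σ_{j ∈ J_i} x_j)² ≤ m}`. -/
noncomputable def Bm (m : ℕ) : Set (Fin (m*m) → Bool) :=
  {x | ∑ i : Fin m,
    ((∑ j : Fin (m*m), if (j : ℕ) / m = (i : ℕ) then bval (x j) else 0) / Real.sqrt m) ^ 2
      ≤ (m : ℝ)}


namespace HS

open Finset

/-- Expectation over the cube indexed by a finite type. -/
noncomputable def E {ι : Type*} [Fintype ι] [DecidableEq ι] (f : (ι → Bool) → ℝ) : ℝ :=
  (∑ x : ι → Bool, f x) / 2 ^ (Fintype.card ι)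

open Classical in
/-- Indicator of a proposition. -/
noncomputable def ind (p : Prop) : ℝ := if p then 1 else 0

lemma ind_pos {p : Prop} (h : p) : ind p = 1 := if_pos h
lemma ind_neg {p : Prop} (h : ¬ p) : ind p = 0 := if_neg h
lemma ind_nonneg (p : Prop) : 0 ≤ ind p := by
  unfold ind; split_ifs <;> norm_num
lemma ind_le_one (p : Prop) : ind p ≤ 1 := by
  unfold ind; split_ifs <;> norm_num
open Classical in
lemma sum_ind {α : Type*} [Fintype α] (p : α → Prop) :
    ∑ x, ind (p x) = ((univ.filter p).card : ℝ) := by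
  simp [ind, Finset.sum_boole]
lemma ind_mono {p q : Prop} (h : p → q) : ind p ≤ ind q := by
  by_cases hp : p
  · rw [ind_pos hp, ind_pos (h hp)]
  · rw [ind_neg hp]; exact ind_nonneg q

/-- Probability on the cube. -/
noncomputable def pr {ι : Type*} [Fintype ι] [DecidableEq ι] (p : (ι → Bool) → Prop) : ℝ :=
  E (fun x => ind (p x))

section basic
variable {ι : Type*} [Fintype ι] [DecidableEq ι]

lemma E_mono {f g : (ι → Bool) → ℝ} (h : ∀ x, f x ≤ g x) : E f ≤ E g := by
  unfold E
  gcongr with x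
  exact h x

lemma E_add (f g : (ι → Bool) → ℝ) : E (fun x => f x + g x) = E f + E g := by
  unfold E
  rw [sum_add_distrib, add_div]

lemma E_sub (f g : (ι → Bool) → ℝ) : E (fun x => f x - g x) = E f - E g := by
  unfold E
  rw [sum_sub_distrib, sub_div]

lemma E_mul_left (c : ℝ) (f : (ι → Bool) → ℝ) : E (fun x => c * f x) = c * E f := by
  unfold E
  rw [← mul_sum, mul_div_assoc]

lemma E_sum {κ : Type*} (s : Finset κ) (f : κ → (ι → Bool) → ℝ) :
    E (fun x => ∑ i ∈ s, f i x) = ∑ i ∈ s, E (f i) := by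
  unfold E
  rw [sum_comm, sum_div]

lemma E_const (c : ℝ) : E (fun _ : ι → Bool => c) = c := by
  unfold E
  simp

lemma E_nonneg {f : (ι → Bool) → ℝ} (h : ∀ x, 0 ≤ f x) : 0 ≤ E f := by
  have := E_mono (f := fun _ => 0) h
  rwa [E_const] at this

lemma pr_le_one (p : (ι → Bool) → Prop) : pr p ≤ 1 := by
  rw [← E_const (ι := ι) 1]
  exact E_mono fun x => ind_le_one _

lemma pr_mono {p q : (ι → Bool) → Prop} (h : ∀ x, p x → q x) : pr p ≤ pr q := by
  exact E_mono fun x => ind_mono (h x)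

lemma E_abs_le (f : (ι → Bool) → ℝ) : E (fun x => |f x|) ≤ √(E (fun x => f x ^ 2)) := by
  apply Real.le_sqrt_of_sq_le
  unfold E
  have h := sq_sum_le_card_mul_sum_sq (s := (univ : Finset (ι → Bool))) (f := fun x => |f x|)
  have hc : ((univ : Finset (ι → Bool)).card : ℝ) = 2 ^ (Fintype.card ι) := by
    simp
  rw [hc] at h
  simp only [sq_abs] at h
  have : (0:ℝ) < 2 ^ (Fintype.card ι) := by positivity
  rw [div_pow, div_le_div_iff₀ (by positivity) (by positivity)]
  nlinarith

/-- flipping -/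
def flip (d x : ι → Bool) : ι → Bool := fun j => xor (d j) (x j)

lemma E_flip (d : ι → Bool) (f : (ι → Bool) → ℝ) : E (fun x => f (flip d x)) = E f := by
  unfold E
  congr 1
  apply Finset.sum_bijective (flip d) (Function.Involutive.bijective _)
  · simp
  · simp
  · intro x; funext j; simp [flip]

lemma E_avg {κ : Type*} [Fintype κ] [DecidableEq κ] (D : (κ → Bool) → (ι → Bool))
    (f : (ι → Bool) → ℝ) : E f = E (fun x => E (fun d => f (flip (D d) x))) := by
  have h : E (fun d : κ → Bool => E (fun x => f (flip (D d) x))) = E f := by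
    simp only [E_flip, E_const]
  rw [← h]
  unfold E
  simp only [sum_div]
  rw [sum_comm]
  refine sum_congr rfl fun x _ => sum_congr rfl fun y _ => ?_
  rw [div_div, div_div, mul_comm]

@[simp] lemma bval_xor (a b : Bool) : bval (xor a b) = - (bval a * bval b) := by
  cases a <;> cases b <;> simp [bval]

lemma bval_sq (a : Bool) : bval a * bval a = 1 := by
  cases a <;> simp [bval]

lemma abs_bval (a : Bool) : |bval a| = 1 := by
  cases a <;> simp [bval]

end basic

section LO

lemma central_bound (n : ℕ) : ((2*n).choose n)^2 * (2*n+1) ≤ 16^n := by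
  rw [← Nat.centralBinom_eq_two_mul_choose]
  induction n with
  | zero => simp
  | succ n ih =>
    have h := Nat.succ_mul_centralBinom_succ n
    have h2 : (n+1)^2 * (Nat.centralBinom (n+1) ^2 * (2*(n+1)+1)) ≤ (n+1)^2 * 16^(n+1) := by
      calc (n+1)^2 * (Nat.centralBinom (n+1) ^2 * (2*(n+1)+1))
          = ((n+1) * Nat.centralBinom (n+1))^2 * (2*(n+1)+1) := by ring
        _ = (Nat.centralBinom n ^2 * (2*n+1)) * (4*((2*n+1)*(2*n+3))) := by rw [h]; ring
        _ ≤ 16^n * (4*((2*n+1)*(2*n+3))) := by gcongr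
        _ ≤ 16^n * (16 * (n+1)^2) := by
            apply Nat.mul_le_mul_left; nlinarith
        _ = _ := by ring
    exact Nat.le_of_mul_le_mul_left h2 (by positivity)

lemma choose_half_bound (K : ℕ) (hK : 0 < K) : ((K.choose (K/2) : ℕ) : ℝ) / 2^K ≤ 1 / √K := by
  have key : (K.choose (K/2))^2 * K ≤ 4^K := by
    rcases Nat.even_or_odd' K with ⟨n, rfl | rfl⟩
    · have := central_bound n
      have h2 : 2*n/2 = n := by omega
      rw [h2, pow_mul]
      norm_num
      nlinarith [Nat.zero_le (((2*n).choose n)^2)]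
    · have := central_bound (n+1)
      have h2 : (2*n+1)/2 = n := by omega
      rw [h2]
      have h3 : (2*(n+1)).choose (n+1) = 2 * (2*n+1).choose n := by
        have : 2*(n+1) = (2*n+1)+1 := by ring
        rw [this, Nat.choose_succ_succ, Nat.choose_symm_half]; ring
      rw [h3] at this
      have h4 : 4 ^ (2*n+1) * 4 = 16^(n+1) := by
        rw [← pow_succ, show 2*n+1+1 = 2*(n+1) by ring, pow_mul]; norm_num
      nlinarith [Nat.zero_le (((2*n+1).choose n)^2)]
  have hs : (0:ℝ) < √K := Real.sqrt_pos.2 (by exact_mod_cast hK)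
  rw [div_le_div_iff₀ (by positivity) hs, one_mul]
  apply le_of_sq_le_sq _ (by positivity)
  rw [mul_pow, Real.sq_sqrt (by positivity), ← pow_mul, mul_comm K 2, pow_mul]
  norm_num
  exact_mod_cast key

lemma lo0 {κ : Type*} [Fintype κ] [DecidableEq κ] (c : κ → ℝ) (c0 b s : ℝ) (hs : 0 < s)
    (hκ : 0 < Fintype.card κ) (hc : ∀ i, s ≤ |c i|) :
    pr (fun d : κ → Bool => b < c0 + ∑ i, c i * bval (d i) ∧
      c0 + ∑ i, c i * bval (d i) < b + 2 * s) ≤ 1 / √(Fintype.card κ) := by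
  classical
  refine le_trans ?_ (choose_half_bound _ hκ)
  unfold pr E
  gcongr
  rw [sum_ind, Nat.cast_le]
  let F : (κ → Bool) → Finset κ := fun d => {i | d i = decide (0 < c i)}
  have hF : Function.Injective F := by
    intro d e h
    funext i
    have := congrArg (fun S => i ∈ S) h
    simp only [F, mem_filter, mem_univ, true_and, eq_iff_iff] at this
    generalize decide (0 < c i) = z at this
    cases hd : d i <;> cases he : e i <;> cases z <;> simp_all
  rw [← Finset.card_image_of_injective _ hF]
  apply IsAntichain.sperner
  intro S hS S' hS' hne hsub
  simp only [coe_image, Set.mem_image, mem_coe] at hS hS'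
  obtain ⟨d, hd, rfl⟩ := hS
  obtain ⟨e, he, rfl⟩ := hS'
  simp only [mem_filter, mem_univ, true_and] at hd he
  have hterm : ∀ i, c i * bval (d i) ≤ c i * bval (e i) := by
    intro i
    have h1 := @hsub i
    simp only [F, mem_filter, mem_univ, true_and] at h1
    by_cases hci : 0 < c i
    · cases hdi : d i <;> cases hei : e i <;> simp_all [bval] <;> linarith
    · have : c i ≤ 0 := not_lt.1 hci
      cases hdi : d i <;> cases hei : e i <;> simp_all [bval] <;> linarith
  obtain ⟨i, hi1, hi2⟩ := Finset.not_subset.1 (fun h => hne (Finset.Subset.antisymm hsub h))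
  have hstrict : c i * bval (d i) + 2 * s ≤ c i * bval (e i) := by
    simp only [F, mem_filter, mem_univ, true_and] at hi1 hi2
    have hci' := hc i
    by_cases hci : 0 < c i
    · rw [abs_of_pos hci] at hci'
      cases hdi : d i <;> cases hei : e i <;> simp_all [bval] <;> linarith
    · have : c i ≤ 0 := not_lt.1 hci
      rw [abs_of_nonpos this] at hci'
      cases hdi : d i <;> cases hei : e i <;> simp_all [bval] <;> linarith
  have hsum : ∑ j, c j * bval (d j) + 2 * s ≤ ∑ j, c j * bval (e j) := by
    rw [← Finset.add_sum_erase _ _ (mem_univ i), ← Finset.add_sum_erase univ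
      (fun j => c j * bval (e j)) (mem_univ i)]
    have := Finset.sum_le_sum (s := univ.erase i) (fun j _ => hterm j)
    linarith
  linarith [hd.1, he.2]

variable {ι : Type*} [Fintype ι] [DecidableEq ι]

lemma lo1 (c : ι → ℝ) (c0 b s : ℝ) (hs : 0 < s) (S : Finset ι)
    (hS : 0 < S.card) (hc : ∀ i ∈ S, s ≤ |c i|) :
    pr (fun d : ι → Bool => b < c0 + ∑ i, c i * bval (d i) ∧
      c0 + ∑ i, c i * bval (d i) < b + 2 * s) ≤ 1 / √(S.card) := by
  unfold pr
  rw [E_avg (κ := S) (fun d j => if h : j ∈ S then d ⟨j, h⟩ else false)]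
  rw [← E_const (ι := ι) (1 / √(S.card))]
  apply E_mono
  intro x
  have key := lo0 (κ := S) (fun i => - (c i * bval (x i)))
    (c0 + ∑ i ∈ Sᶜ, c i * bval (x i)) b s hs (by simpa using hS) (by
      intro i
      rw [abs_neg, abs_mul, abs_bval, mul_one]
      exact hc i i.2)
  rw [Fintype.card_coe] at key
  refine le_trans (le_of_eq ?_) key
  unfold pr
  congr 1
  funext d
  have : c0 + ∑ i, c i * bval (flip (fun j => if h : j ∈ S then d ⟨j, h⟩ else false) x i)
      = c0 + ∑ i ∈ Sᶜ, c i * bval (x i) + ∑ i : S, - (c i * bval (x i)) * bval (d i) := by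
    rw [← Finset.sum_add_sum_compl S, ← Finset.sum_coe_sort S, add_assoc, add_comm (∑ i ∈ Sᶜ, _)]
    congr 2
    · refine sum_congr rfl fun i _ => ?_
      simp [flip]
      ring
    · refine sum_congr rfl fun i hi => ?_
      simp only [mem_compl] at hi
      simp [flip, hi]
  dsimp only
  rw [this]

/-- Littlewood--Offord. -/
lemma lo (c : ι → ℝ) (c0 b s w : ℝ) (hs : 0 < s) (hw : 0 ≤ w) (S : Finset ι)
    (hS : 0 < S.card) (hc : ∀ i ∈ S, s ≤ |c i|) :
    pr (fun d : ι → Bool => b < c0 + ∑ i, c i * bval (d i) ∧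
      c0 + ∑ i, c i * bval (d i) < b + w) ≤ (w / s + 1) / √(S.card) := by
  classical
  set T : (ι → Bool) → ℝ := fun d => c0 + ∑ i, c i * bval (d i) with hT
  have h1 : pr (fun d : ι → Bool => b < T d ∧ T d < b + w) ≤
      ∑ i ∈ range ⌈w/s⌉₊, pr (fun d : ι → Bool => b + i * s < T d ∧ T d < b + i * s + 2 * s) := by
    unfold pr
    rw [← E_sum]
    apply E_mono
    intro x
    by_cases h : b < T x ∧ T x < b + w
    · rw [ind_pos h]
      obtain ⟨ha, hb⟩ := h
      have hpos : 0 < (T x - b) / s := div_pos (by linarith) hs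
      have hn : 1 ≤ ⌈(T x - b)/s⌉₊ := Nat.one_le_ceil_iff.2 hpos
      have hmem : ⌈(T x - b)/s⌉₊ - 1 ∈ range ⌈w/s⌉₊ := by
        rw [mem_range]
        have : ⌈(T x - b)/s⌉₊ ≤ ⌈w/s⌉₊ := Nat.ceil_mono (by gcongr; linarith)
        omega
      refine le_trans ?_ (Finset.single_le_sum (f := fun i : ℕ => ind (b + i * s < T x ∧
        T x < b + i * s + 2 * s)) (fun i _ => ind_nonneg _) hmem)
      rw [ind_pos]
      have h3 := Nat.le_ceil ((T x - b)/s)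
      have h4 := Nat.ceil_lt_add_one hpos.le
      rw [Nat.cast_sub hn]
      rw [div_le_iff₀ hs] at h3
      have h5 : (⌈(T x - b)/s⌉₊ - 1 : ℝ) * s < T x - b := by
        rw [← lt_div_iff₀ hs]; linarith
      push_cast
      constructor <;> nlinarith
    · rw [ind_neg h]
      exact sum_nonneg fun i _ => ind_nonneg _
  refine h1.trans ?_
  have h2 : ∀ i ∈ range ⌈w/s⌉₊, pr (fun d : ι → Bool => b + i * s < T d ∧ T d < b + i * s + 2 * s)
     ≤ 1 / √(S.card) := fun i _ => lo1 c c0 (b + i * s) s hs S hS hc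
  refine (Finset.sum_le_sum h2).trans ?_
  rw [sum_const, card_range, nsmul_eq_mul, mul_one_div]
  gcongr
  exact (Nat.ceil_lt_add_one (by positivity)).le

end LO

end HS

namespace HS

open Finset

section cov
variable {ι : Type*} [Fintype ι] [DecidableEq ι]

/-- Discrete derivative. -/
noncomputable def Der (j : ι) (f : (ι → Bool) → ℝ) (x : ι → Bool) : ℝ :=
  (f (Function.update x j true) - f (Function.update x j false)) / 2

lemma sum_avg (j : ι) (F : (ι → Bool) → ℝ) :
    ∑ x, F x = ∑ x, (F (Function.update x j true) + F (Function.update x j false)) / 2 := by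
  have h := E_flip (Function.update (fun _ => false) j true) F
  unfold E at h
  rw [div_left_inj' (by positivity)] at h
  have h2 : ∀ x : ι → Bool, F (Function.update x j true) + F (Function.update x j false) =
      F x + F (flip (Function.update (fun _ => false) j true) x) := by
    intro x
    cases hx : x j
    · have h3 : Function.update x j false = x := by rw [← hx]; simp
      have h4 : flip (Function.update (fun _ => false) j true) x = Function.update x j true := by
        funext i
        by_cases hi : i = j
        · subst hi; simp [flip, hx]
        · simp [flip, hi]
      rw [h3, h4, add_comm]
    · have h3 : Function.update x j true = x := by rw [← hx]; simp
      have h4 : flip (Function.update (fun _ => false) j true) x = Function.update x j false := by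
        funext i
        by_cases hi : i = j
        · subst hi; simp [flip, hx]
        · simp [flip, hi]
      rw [h3, h4]
  simp only [h2, ← sum_div, sum_add_distrib, h]
  ring

lemma sum_der (j : ι) (f W : (ι → Bool) → ℝ)
    (hW : ∀ x b, W (Function.update x j b) = W x) :
    ∑ x, f x * bval (x j) * W x = ∑ x, Der j f x * W x := by
  rw [sum_avg j]
  refine sum_congr rfl fun x _ => ?_
  simp only [hW, Function.update_self, bval, Der]
  simp
  ring

lemma Der_update (j : ι) (f : (ι → Bool) → ℝ) (x : ι → Bool) (b : Bool) :
    Der j f (Function.update x j b) = Der j f x := by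
  simp [Der]

lemma Der_Der (j : ι) (f : (ι → Bool) → ℝ) (x : ι → Bool) : Der j (Der j f) x = 0 := by
  rw [Der, Der_update, Der_update]; simp

/-- Mehler kernel -/
noncomputable def Ker (p : ℝ) (x y : ι → Bool) : ℝ := ∏ l, (1 + p * (bval (x l) * bval (y l)))

lemma Ker_nonneg {p : ℝ} (h0 : 0 ≤ p) (h1 : p ≤ 1) (x y : ι → Bool) : 0 ≤ Ker p x y := by
  apply prod_nonneg
  intro l _
  cases x l <;> cases y l <;> simp [bval] <;> linarith

lemma Ker_sum (p : ℝ) (x : ι → Bool) : ∑ y, Ker p x y = 2 ^ (Fintype.card ι) := by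
  unfold Ker
  have h := Finset.prod_univ_sum (fun _ : ι => (univ : Finset Bool))
    (fun l b => 1 + p * (bval (x l) * bval b))
  rw [Fintype.piFinset_univ] at h
  rw [← h]
  have : ∀ l, ∑ b : Bool, (1 + p * (bval (x l) * bval b)) = 2 := by
    intro l
    simp [bval]
    ring
  rw [prod_congr rfl (fun l _ => this l)]
  simp

lemma ker_der (p : ℝ) (f g : (ι → Bool) → ℝ) (j : ι) :
    ∑ x, ∑ y, f x * g y * (bval (x j) * bval (y j) *
        ∏ l ∈ univ.erase j, (1 + p * (bval (x l) * bval (y l)))) =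
      ∑ x, ∑ y, Der j f x * Der j g y * Ker p x y := by
  set W : (ι → Bool) → (ι → Bool) → ℝ := fun x y =>
    ∏ l ∈ univ.erase j, (1 + p * (bval (x l) * bval (y l))) with hW
  have hWx : ∀ y x b, W (Function.update x j b) y = W x y := by
    intro y x b
    refine prod_congr rfl fun l hl => ?_
    rw [Function.update_of_ne (ne_of_mem_erase hl)]
  have hWy : ∀ x y b, W x (Function.update y j b) = W x y := by
    intro x y b
    refine prod_congr rfl fun l hl => ?_
    rw [Function.update_of_ne (ne_of_mem_erase hl)]
  have hK : ∀ x y, Ker p x y = W x y + p * (bval (x j) * bval (y j) * W x y) := by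
    intro x y
    unfold Ker
    rw [← mul_prod_erase univ _ (mem_univ j)]
    simp only [hW]; ring
  have key : ∀ f g : (ι → Bool) → ℝ,
      ∑ x, ∑ y, f x * g y * (bval (x j) * bval (y j) * W x y) =
      ∑ x, ∑ y, Der j f x * Der j g y * W x y := by
    intro f g
    calc ∑ x, ∑ y, f x * g y * (bval (x j) * bval (y j) * W x y)
        = ∑ x, f x * bval (x j) * ∑ y, g y * bval (y j) * W x y := by
          refine sum_congr rfl fun x _ => ?_
          rw [mul_sum]
          refine sum_congr rfl fun y _ => ?_
          ring
      _ = ∑ x, f x * bval (x j) * ∑ y, Der j g y * W x y := by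
          refine sum_congr rfl fun x _ => ?_
          rw [sum_der j g (W x) (hWy x)]
      _ = ∑ y, Der j g y * ∑ x, f x * bval (x j) * W x y := by
          simp only [mul_sum]
          rw [sum_comm]
          refine sum_congr rfl fun y _ => sum_congr rfl fun x _ => ?_
          ring
      _ = ∑ y, Der j g y * ∑ x, Der j f x * W x y := by
          refine sum_congr rfl fun y _ => ?_
          rw [sum_der j f (fun x => W x y) (hWx y)]
      _ = _ := by
          simp only [mul_sum]
          rw [sum_comm]
          refine sum_congr rfl fun y _ => sum_congr rfl fun x _ => ?_
          ring
  rw [key f g]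
  have h2 := key (Der j f) (Der j g)
  simp only [Der_Der, zero_mul, sum_const_zero] at h2
  have h3 : ∀ x y, Der j f x * Der j g y * Ker p x y = Der j f x * Der j g y * W x y +
      p * (Der j f x * Der j g y * (bval (x j) * bval (y j) * W x y)) := by
    intro x y
    rw [hK]; ring
  simp only [h3, sum_add_distrib, ← mul_sum, h2]
  simp

lemma cov_le (f g G : (ι → Bool) → ℝ) (hG : ∀ x y, ∑ j, Der j f x * Der j g y ≤ G x) :
    E (fun x => f x * g x) - E f * E g ≤ E G := by
  set N := Fintype.card ι with hN
  let h : ℝ → ℝ := fun p => ∑ x, ∑ y, f x * g y * Ker p x y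
  let h' : ℝ → ℝ := fun p => ∑ x, ∑ y, f x * g y * ∑ j, ((bval (x j) * bval (y j)) *
        ∏ l ∈ univ.erase j, (1 + p * (bval (x l) * bval (y l))))
  have hd : ∀ p, HasDerivAt h (h' p) p := by
    intro p
    apply HasDerivAt.fun_sum
    intro x _
    apply HasDerivAt.fun_sum
    intro y _
    apply HasDerivAt.const_mul
    have := HasDerivAt.fun_finsetProd (u := (univ : Finset ι)) (x := p)
      (f := fun l p => 1 + p * (bval (x l) * bval (y l)))
      (f' := fun l => bval (x l) * bval (y l)) (by
        intro l _
        simpa using ((hasDerivAt_id p).mul_const (bval (x l) * bval (y l))).const_add 1)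
    unfold Ker
    convert this using 1
    refine sum_congr rfl fun j _ => ?_
    rw [smul_eq_mul, mul_comm]
  have hh' : ∀ p, h' p = ∑ x, ∑ y, (∑ j, Der j f x * Der j g y) * Ker p x y := by
    intro p
    have := fun j => ker_der p f g j
    calc h' p = ∑ j, ∑ x, ∑ y, f x * g y * (bval (x j) * bval (y j) *
        ∏ l ∈ univ.erase j, (1 + p * (bval (x l) * bval (y l)))) := by
          simp only [h', mul_sum]
          symm
          rw [sum_comm]
          refine sum_congr rfl fun x _ => ?_
          rw [sum_comm]
      _ = _ := by
          simp only [this, sum_mul]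
          rw [sum_comm]
          refine sum_congr rfl fun x _ => ?_
          rw [sum_comm]
  have h1 : h 1 = 2 ^ N * ∑ x, f x * g x := by
    have hk : ∀ x y : ι → Bool, Ker 1 x y = if x = y then 2 ^ N else 0 := by
      intro x y
      unfold Ker
      split_ifs with hxy
      · subst hxy
        simp only [bval_sq, one_mul]
        norm_num [hN]
      · obtain ⟨l, hl⟩ := Function.ne_iff.1 hxy
        apply prod_eq_zero (mem_univ l)
        cases hx : x l <;> cases hy : y l <;> simp_all [bval]
    simp only [h, hk, mul_ite, mul_zero, sum_ite_eq, mem_univ, if_true]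
    rw [mul_sum]
    exact sum_congr rfl fun x _ => by ring
  have h0 : h 0 = (∑ x, f x) * ∑ x, g x := by
    simp [h, Ker, sum_mul_sum]
  obtain ⟨p, hp, hpe⟩ := exists_hasDerivAt_eq_slope h h' zero_lt_one
    (fun p _ => (hd p).continuousAt.continuousWithinAt) (fun p _ => hd p)
  have hb : h' p ≤ 2 ^ N * ∑ x, G x := by
    rw [hh', mul_sum]
    refine sum_le_sum fun x _ => ?_
    calc ∑ y, (∑ j, Der j f x * Der j g y) * Ker p x y ≤ ∑ y, G x * Ker p x y := by
          refine sum_le_sum fun y _ => ?_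
          exact mul_le_mul_of_nonneg_right (hG x y) (Ker_nonneg hp.1.le hp.2.le x y)
      _ = _ := by rw [← mul_sum, Ker_sum, mul_comm]
  rw [hpe, h1, h0] at hb
  have hN2 : (0:ℝ) < 2 ^ N := by positivity
  unfold E
  rw [← hN]
  have e : (∑ x, f x * g x) / 2 ^ N - (∑ x, f x) / 2 ^ N * ((∑ x, g x) / 2 ^ N) =
    ((2 ^ N * ∑ x, f x * g x - (∑ x, f x) * ∑ x, g x) / (1 - 0)) / (2 ^ N * 2 ^ N) := by
    field_simp
    ring
  rw [e, div_le_div_iff₀ (by positivity) (by positivity)]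
  nlinarith

lemma E_lin_sq (c : ι → ℝ) : E (fun x => (∑ l, c l * bval (x l)) ^ 2) = ∑ l, c l ^ 2 := by
  have h : ∀ i j, E (fun x : ι → Bool => bval (x i) * bval (x j)) = if i = j then 1 else 0 := by
    intro i j
    split_ifs with hij
    · subst hij
      simp only [bval_sq, E_const]
    · unfold E
      have := sum_der i (fun _ => 1) (fun x => bval (x j)) (by
        intro x b
        rw [Function.update_of_ne (Ne.symm hij)])
      simp only [one_mul] at this
      rw [this]
      simp [Der]
  have h2 : ∀ x : ι → Bool, (∑ l, c l * bval (x l)) ^ 2 =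
      ∑ i, ∑ j, (c i * c j) * (bval (x i) * bval (x j)) := by
    intro x
    rw [sq, sum_mul_sum]
    refine sum_congr rfl fun i _ => sum_congr rfl fun j _ => by ring
  simp only [h2, E_sum, E_mul_left, h]
  simp [sq]

end cov
end HS

namespace HS

open Finset

lemma smooth_exists : ∃ (C : ℝ) (D : ℝ → ℝ), 1 ≤ C ∧ (∀ z, |D z| ≤ C) ∧
    (∀ u u', |Real.smoothTransition u - Real.smoothTransition u'| ≤ C * |u - u'|) ∧
    (∀ u h z, |z - u| ≤ |h| → |(Real.smoothTransition (u + h) - Real.smoothTransition (u - h)) / 2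
      - h * D z| ≤ C * h ^ 2) := by
  have hcd : ContDiff ℝ 2 Real.smoothTransition := Real.smoothTransition.contDiff (n := 2)
  have hdiff : Differentiable ℝ Real.smoothTransition := hcd.differentiable (by norm_num)
  have hcd' : ContDiff ℝ 1 (deriv Real.smoothTransition) := by
    have : ContDiff ℝ (1 + 1) Real.smoothTransition := by norm_num; exact hcd
    exact (contDiff_succ_iff_deriv.1 this).2.2
  have hsupp : HasCompactSupport (deriv Real.smoothTransition) := by
    apply HasCompactSupport.intro (isCompact_Icc (a := (0:ℝ)) (b := 1))
    intro x hx
    rw [Set.mem_Icc, not_and_or, not_le, not_le] at hx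
    rcases hx with hx | hx
    · have : Real.smoothTransition =ᶠ[nhds x] fun _ => 0 := by
        filter_upwards [gt_mem_nhds hx] with y hy
        exact Real.smoothTransition.zero_of_nonpos hy.le
      rw [this.deriv_eq]; simp
    · have : Real.smoothTransition =ᶠ[nhds x] fun _ => 1 := by
        filter_upwards [lt_mem_nhds hx] with y hy
        exact Real.smoothTransition.one_of_one_le hy.le
      rw [this.deriv_eq]; simp
  obtain ⟨C1, hC1⟩ := hsupp.exists_bound_of_continuous hcd'.continuous
  obtain ⟨C2, hC2⟩ := ContDiff.lipschitzWith_of_hasCompactSupport hsupp hcd' (by norm_num)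
  have hC1' : 0 ≤ C1 := (norm_nonneg _).trans (hC1 0)
  have mvt : ∀ u h, ∃ ξ, |ξ - u| ≤ |h| ∧
      (Real.smoothTransition (u + h) - Real.smoothTransition (u - h)) / 2 =
        h * deriv Real.smoothTransition ξ := by
    have pos : ∀ u h, 0 < h → ∃ ξ, |ξ - u| ≤ |h| ∧
      (Real.smoothTransition (u + h) - Real.smoothTransition (u - h)) / 2 =
        h * deriv Real.smoothTransition ξ := by
      intro u h hh
      obtain ⟨ξ, hξ, he⟩ := exists_deriv_eq_slope Real.smoothTransition
        (show u - h < u + h by linarith) hdiff.continuous.continuousOn hdiff.differentiableOn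
      refine ⟨ξ, ?_, ?_⟩
      · rw [abs_of_pos hh, abs_le]
        constructor <;> linarith [hξ.1, hξ.2]
      · rw [he]
        have : u + h - (u - h) = 2 * h := by ring
        rw [this]; field_simp
    intro u h
    rcases lt_trichotomy h 0 with hh | hh | hh
    · obtain ⟨ξ, h1, h2⟩ := pos u (-h) (by linarith)
      refine ⟨ξ, by simpa using h1, ?_⟩
      rw [← sub_eq_add_neg, sub_neg_eq_add] at h2
      linarith
    · exact ⟨u, by simp, by simp [hh]⟩
    · exact pos u h hh
  refine ⟨1 + C1 + 2 * C2, deriv Real.smoothTransition, ?_, ?_, ?_, ?_⟩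
  · have := C2.2
    have h2 : (0:ℝ) ≤ C2 := C2.2
    linarith
  · intro z
    have h2 : (0:ℝ) ≤ C2 := C2.2
    have := hC1 z
    rw [Real.norm_eq_abs] at this
    linarith
  · intro u u'
    have h2 : (0:ℝ) ≤ C2 := C2.2
    obtain ⟨ξ, _, h⟩ := mvt ((u + u')/2) ((u - u')/2)
    have e1 : (u + u')/2 + (u - u')/2 = u := by ring
    have e2 : (u + u')/2 - (u - u')/2 = u' := by ring
    rw [e1, e2] at h
    have : Real.smoothTransition u - Real.smoothTransition u' =
      (u - u') * deriv Real.smoothTransition ξ := by linarith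
    rw [this, abs_mul, mul_comm]
    have := hC1 ξ
    rw [Real.norm_eq_abs] at this
    gcongr
    linarith
  · intro u h z hz
    obtain ⟨ξ, h1, h2⟩ := mvt u h
    rw [h2, ← mul_sub, abs_mul]
    have h3 := hC2.dist_le_mul ξ z
    rw [Real.dist_eq, Real.dist_eq] at h3
    have h4 : |ξ - z| ≤ 2 * |h| := by
      have := abs_sub_le ξ u z
      rw [abs_sub_comm u z] at this
      linarith
    have h2 : (0:ℝ) ≤ C2 := C2.2
    have h5 : (C2:ℝ) * |ξ - z| ≤ C2 * (2 * |h|) := by gcongr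
    rw [← sq_abs h]
    have := abs_nonneg h
    nlinarith [mul_nonneg hC1' (sq_nonneg |h|)]

section smoothing
variable {ι : Type*} [Fintype ι] [DecidableEq ι]

/-- smoothed indicator of `F ≤ b` at width `w` -/
noncomputable def smo (F : (ι → Bool) → ℝ) (b w : ℝ) (x : ι → Bool) : ℝ :=
  Real.smoothTransition ((b + w - F x) / w)

lemma smo_nonneg (F : (ι → Bool) → ℝ) (b w : ℝ) (x : ι → Bool) : 0 ≤ smo F b w x :=
  Real.smoothTransition.nonneg _

lemma smo_le_one (F : (ι → Bool) → ℝ) (b w : ℝ) (x : ι → Bool) : smo F b w x ≤ 1 :=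
  Real.smoothTransition.le_one _

lemma smo_approx (F : (ι → Bool) → ℝ) (b w : ℝ) (hw : 0 < w) (x : ι → Bool) :
    |ind (F x ≤ b) - smo F b w x| ≤ ind (b < F x ∧ F x < b + w) := by
  by_cases h1 : F x ≤ b
  · rw [ind_pos h1]
    unfold smo
    rw [Real.smoothTransition.one_of_one_le]
    · simpa using ind_nonneg _
    · rw [le_div_iff₀ hw]; linarith
  · rw [ind_neg h1]
    by_cases h2 : F x < b + w
    · rw [ind_pos ⟨not_le.1 h1, h2⟩, zero_sub, abs_neg, abs_of_nonneg (smo_nonneg _ _ _ _)]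
      exact smo_le_one _ _ _ _
    · unfold smo
      rw [Real.smoothTransition.zero_of_nonpos]
      · simpa using ind_nonneg _
      · apply div_nonpos_of_nonpos_of_nonneg _ hw.le
        linarith [not_lt.1 h2]

lemma abs_Der_smo_le_one (F : (ι → Bool) → ℝ) (b w : ℝ) (j : ι) (x : ι → Bool) :
    |Der j (smo F b w) x| ≤ 1 := by
  unfold Der
  rw [abs_le]
  have h1 := smo_nonneg F b w (Function.update x j true)
  have h2 := smo_nonneg F b w (Function.update x j false)
  have h3 := smo_le_one F b w (Function.update x j true)
  have h4 := smo_le_one F b w (Function.update x j false)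
  constructor <;> linarith

lemma smo_der1 {C : ℝ}
    (hC : ∀ u u', |Real.smoothTransition u - Real.smoothTransition u'| ≤ C * |u - u'|)
    (F : (ι → Bool) → ℝ) (b w : ℝ) (hw : 0 < w) (j : ι) (x : ι → Bool) :
    |Der j (smo F b w) x| ≤ C * |Der j F x| / w := by
  unfold Der smo
  rw [abs_div, abs_div]
  have := hC ((b + w - F (Function.update x j true)) / w)
    ((b + w - F (Function.update x j false)) / w)
  rw [← sub_div, abs_div, abs_of_pos hw] at this
  have e : b + w - F (Function.update x j true) - (b + w - F (Function.update x j false)) =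
    -(F (Function.update x j true) - F (Function.update x j false)) := by ring
  rw [e, abs_neg] at this
  calc _ ≤ (C * (|F (Function.update x j true) - F (Function.update x j false)| / w)) / |2| := by
        gcongr
    _ = _ := by ring

lemma smo_der2 {C : ℝ} {D : ℝ → ℝ}
    (hC : ∀ u h z, |z - u| ≤ |h| → |(Real.smoothTransition (u + h) -
      Real.smoothTransition (u - h)) / 2 - h * D z| ≤ C * h ^ 2)
    (F : (ι → Bool) → ℝ) (b w : ℝ) (hw : 0 < w) (j : ι) (x : ι → Bool) :
    |Der j (smo F b w) x + Der j F x / w * D ((b + w - F x) / w)| ≤ C * Der j F x ^ 2 / w ^ 2 := by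
  set ft := F (Function.update x j true) with hft
  set ff := F (Function.update x j false) with hff
  have hD : Der j F x = (ft - ff) / 2 := rfl
  have := hC ((b + w - (ft + ff) / 2) / w) (- (Der j F x) / w) ((b + w - F x) / w) (by
    rw [← sub_div, abs_div, abs_div, abs_of_pos hw, hD]
    apply div_le_div_of_nonneg_right _ hw.le
    apply le_of_eq
    cases hx : x j
    · have h3 : F x = ff := by rw [hff, ← hx]; simp
      rw [h3, abs_neg]
      congr 1
      ring
    · have h3 : F x = ft := by rw [hft, ← hx]; simp
      rw [h3]
      congr 1
      ring)
  have e1 : (b + w - (ft + ff) / 2) / w + - (Der j F x) / w = (b + w - ft) / w := by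
    rw [hD]; ring
  have e2 : (b + w - (ft + ff) / 2) / w - - (Der j F x) / w = (b + w - ff) / w := by
    rw [hD]; ring
  rw [e1, e2] at this
  calc _ = |(Real.smoothTransition ((b + w - ft) / w) - Real.smoothTransition ((b + w - ff) / w)) / 2
          - -Der j F x / w * D ((b + w - F x) / w)| := by
        congr 1
        simp only [Der, smo, hft, hff]
        ring
    _ ≤ _ := this
    _ = _ := by ring

end smoothing
end HS

namespace HS

open Finset

section half
variable {ι : Type*} [Fintype ι] [DecidableEq ι]

lemma exists_sorted (a : ι → ℝ) :
    ∃ e : Fin (Fintype.card ι) ≃ ι, Antitone (fun j => |a (e j)|) := by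
  let e0 := (Fintype.equivFin ι).symm
  let σ := Tuple.sort (fun j => - |a (e0 j)|)
  have h := Tuple.monotone_sort (fun j => - |a (e0 j)|)
  refine ⟨σ.trans e0, fun i j hij => ?_⟩
  have := h hij
  simp only [Function.comp] at this
  simp only [Equiv.trans_apply]
  linarith

lemma exists_gap (T : (ι → Bool) → ℝ) (b : ℝ) :
    ∃ w : ℝ, 0 < w ∧ pr (fun x => b < T x ∧ T x < b + w) = 0 := by
  classical
  obtain ⟨w, hw, h⟩ : ∃ w : ℝ, 0 < w ∧ ∀ x, b < T x → b + w ≤ T x := by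
    by_cases hne : (univ.filter (fun x => b < T x)).Nonempty
    · obtain ⟨x0, hx0, hmin⟩ := exists_min_image _ T hne
      simp only [mem_filter, mem_univ, true_and] at hx0 hmin
      exact ⟨T x0 - b, by linarith, fun x hx => by linarith [hmin x hx]⟩
    · refine ⟨1, one_pos, fun x hx => ?_⟩
      exact absurd ⟨x, by simpa using hx⟩ hne
  refine ⟨w, hw, ?_⟩
  unfold pr
  rw [← E_const (ι := ι) 0]
  congr 1
  funext x
  apply ind_neg
  rintro ⟨h1, h2⟩
  linarith [h x h1]

lemma half_lemma (a : ι → ℝ) (b : ℝ) (k : ℕ) (hk : 0 < k) (lam : ℝ) (hlam : 0 < lam) :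
    ∃ (tail : Finset ι) (w : ℝ), 0 < w ∧ tailᶜ.card ≤ k ∧
      √(∑ j ∈ tail, a j ^ 2) ≤ w * lam * √(1 + Real.log (Fintype.card ι)) ∧
      pr (fun x => b < ∑ i, a i * bval (x i) ∧ ∑ i, a i * bval (x i) < b + w) ≤
        1 / √k + 1 / lam := by
  have hsort := exists_sorted a
  generalize Fintype.card ι = N at hsort ⊢
  obtain ⟨e, he⟩ := hsort
  set I : Finset (Fin N) := univ.filter (fun j => k ≤ (j:ℕ)) with hI
  have hcard : ((I.map e.toEmbedding)ᶜ).card ≤ k := by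
    have : (I.map e.toEmbedding)ᶜ = (Iᶜ).map e.toEmbedding := by
      ext i; simp [hI]
    rw [this, card_map]
    have h2 : Iᶜ.card ≤ (range k).card := by
      apply card_le_card_of_injOn (fun j : Fin N => (j:ℕ))
      · intro j hj; simpa [hI] using hj
      · intro i _ j _ h; exact Fin.ext h
    simpa using h2
  have hsum : ∑ j ∈ I.map e.toEmbedding, a j ^ 2 = ∑ j ∈ I, |a (e j)| ^ 2 := by
    rw [sum_map]; simp
  by_cases h0 : ∑ j ∈ I, |a (e j)| ^ 2 = 0
  · obtain ⟨w, hw, hp⟩ := exists_gap (fun x : ι → Bool => ∑ i, a i * bval (x i)) b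
    refine ⟨I.map e.toEmbedding, w, hw, hcard, ?_, ?_⟩
    · rw [hsum, h0]; simp; positivity
    · rw [hp]; positivity
  · have hne : I.Nonempty := by
      by_contra h
      rw [not_nonempty_iff_eq_empty] at h
      rw [h] at h0; simp at h0
    obtain ⟨j0, hj0, hmax⟩ := exists_max_image I (fun j => |a (e j)| ^ 2 * ((j:ℕ) + 1 : ℝ)) hne
    set s := |a (e j0)| with hs
    set K : ℕ := (j0 : ℕ) + 1 with hK
    have hKk : k ≤ K := by
      have : k ≤ (j0:ℕ) := by simpa [hI] using hj0
      omega
    have hbound : ∑ j ∈ I, |a (e j)| ^ 2 ≤ s ^ 2 * K * (1 + Real.log N) := by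
      have hharm := harmonic_le_one_add_log N
      have hh : ((harmonic N : ℚ) : ℝ) = ∑ j : Fin N, ((j:ℕ) + 1 : ℝ)⁻¹ := by
        unfold harmonic
        push_cast
        rw [← Fin.sum_univ_eq_sum_range (fun i => ((i:ℝ) + 1)⁻¹)]
      calc ∑ j ∈ I, |a (e j)| ^ 2 ≤ ∑ j ∈ I, s ^ 2 * K * ((j:ℕ) + 1 : ℝ)⁻¹ := by
            refine sum_le_sum fun j hj => ?_
            have := hmax j hj
            rw [← div_eq_mul_inv, le_div_iff₀ (by positivity)]
            simpa [hK, hs] using this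
        _ = s ^ 2 * K * ∑ j ∈ I, ((j:ℕ) + 1 : ℝ)⁻¹ := by rw [mul_sum]
        _ ≤ s ^ 2 * K * ∑ j : Fin N, ((j:ℕ) + 1 : ℝ)⁻¹ := by
            refine mul_le_mul_of_nonneg_left ?_ (by positivity)
            apply sum_le_sum_of_subset_of_nonneg (subset_univ _)
            intro i _ _; positivity
        _ ≤ _ := by rw [← hh]; gcongr
    have hspos : 0 < s := by
      rcases (abs_nonneg (a (e j0))).lt_or_eq with h | h
      · exact h
      · exfalso
        apply h0
        have hs0 : s = 0 := h.symm
        rw [hs0] at hbound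
        apply le_antisymm (by simpa using hbound)
        exact sum_nonneg fun i _ => by positivity
    have hKpos : 0 < K := by omega
    have hKs : 0 < √(K:ℝ) := Real.sqrt_pos.2 (by exact_mod_cast hKpos)
    refine ⟨I.map e.toEmbedding, s * √K / lam, by positivity, hcard, ?_, ?_⟩
    · rw [hsum]
      calc √(∑ j ∈ I, |a (e j)| ^ 2) ≤ √(s ^ 2 * K * (1 + Real.log N)) := Real.sqrt_le_sqrt hbound
        _ = s * √K * √(1 + Real.log N) := by
            rw [Real.sqrt_mul (by positivity), Real.sqrt_mul (by positivity), Real.sqrt_sq hspos.le]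
        _ = _ := by field_simp
    · set S : Finset ι := (univ.filter (fun j : Fin N => j ≤ j0)).map e.toEmbedding with hS
      have hScard : S.card = K := by
        rw [hS, card_map]
        have : (univ.filter (fun j : Fin N => j ≤ j0)) = Finset.Iic j0 := by ext; simp
        rw [this, Fin.card_Iic]
      have := lo a 0 b s (s * √K / lam) hspos (by positivity) S (by omega) (by
        intro i hi
        simp only [hS, mem_map, mem_filter, mem_univ, true_and] at hi
        obtain ⟨j, hj, rfl⟩ := hi
        exact he hj)
      simp only [zero_add] at this
      refine this.trans ?_
      rw [hScard]
      have e1 : (s * √K / lam / s + 1) / √K = 1 / √K + 1 / lam := by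
        field_simp
        ring
      rw [e1]
      gcongr

end half
end HS

namespace HS

open Finset

section quad
variable {ι : Type*} [Fintype ι] [DecidableEq ι] {m : ℕ}

/-- Block sum. -/
noncomputable def U (β : ι → Fin m) (i : Fin m) (x : ι → Bool) : ℝ :=
  ∑ j, if β j = i then bval (x j) else 0

/-- The quadratic form. -/
noncomputable def QQ (β : ι → Fin m) (x : ι → Bool) : ℝ := ∑ i, (U β i x) ^ 2 / m

/-- Sum over block i intersected with H. -/
noncomputable def PS (β : ι → Fin m) (H : Finset ι) (i : Fin m) (x : ι → Bool) : ℝ :=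
  ∑ j, (if β j = i ∧ j ∈ H then (1:ℝ) else 0) * bval (x j)

lemma PS_anti (β : ι → Fin m) (H : Finset ι) (i : Fin m) (r : ℕ) (hr : 0 < r)
    (hH : r ≤ (univ.filter (fun j => β j = i ∧ j ∈ H)).card) (t : ℝ) (ht : 0 < t) :
    pr (fun x => |PS β H i x| < t) ≤ (2 * t + 1) / √r := by
  have := lo (fun j => if β j = i ∧ j ∈ H then (1:ℝ) else 0) 0 (-t) 1 (2 * t) one_pos
    (by positivity) (univ.filter (fun j => β j = i ∧ j ∈ H)) (by omega) (by
      intro j hj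
      simp only [mem_filter, mem_univ, true_and] at hj
      simp [hj])
  simp only [zero_add, div_one] at this
  refine le_trans ?_ (this.trans ?_)
  · apply pr_mono
    intro x hx
    rw [abs_lt] at hx
    unfold PS at hx
    constructor <;> linarith [hx.1, hx.2]
  · gcongr

lemma U_eq (β : ι → Fin m) (H : Finset ι) (i : Fin m) (x : ι → Bool) :
    U β i x = PS β H i x + PS β Hᶜ i x := by
  unfold U PS
  rw [← sum_add_distrib]
  refine sum_congr rfl fun j _ => ?_
  by_cases h1 : β j = i <;> by_cases h2 : j ∈ H <;> simp [h1, h2]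

/-- flip pattern -/
def pat (β : ι → Fin m) (H : Finset ι) (d : Fin m → Bool) : ι → Bool :=
  fun j => if j ∈ H then d (β j) else false

lemma PS_flip (β : ι → Fin m) (H : Finset ι) (i : Fin m) (x : ι → Bool) (d : Fin m → Bool) :
    PS β H i (flip (pat β H d) x) = - (bval (d i)) * PS β H i x := by
  unfold PS
  rw [mul_sum]
  refine sum_congr rfl fun j _ => ?_
  by_cases h1 : β j = i <;> by_cases h2 : j ∈ H <;> simp [h1, h2, flip, pat]

lemma PSc_flip (β : ι → Fin m) (H : Finset ι) (i : Fin m) (x : ι → Bool) (d : Fin m → Bool) :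
    PS β Hᶜ i (flip (pat β H d) x) = PS β Hᶜ i x := by
  unfold PS
  refine sum_congr rfl fun j _ => ?_
  by_cases h1 : β j = i <;> by_cases h2 : j ∈ H <;> simp [h1, h2, flip, pat]

lemma QQ_flip (β : ι → Fin m) (H : Finset ι) (x : ι → Bool) (d : Fin m → Bool) :
    QQ β (flip (pat β H d) x) = (∑ i, (PS β H i x ^ 2 + PS β Hᶜ i x ^ 2) / m) +
      ∑ i, (- 2 * PS β H i x * PS β Hᶜ i x / m) * bval (d i) := by
  unfold QQ
  rw [← sum_add_distrib]
  refine sum_congr rfl fun i _ => ?_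
  rw [U_eq β H, PS_flip, PSc_flip]
  have := bval_sq (d i)
  have e : (-bval (d i) * PS β H i x + PS β Hᶜ i x) ^ 2 =
    (bval (d i) * bval (d i)) * PS β H i x ^ 2 + PS β Hᶜ i x ^ 2
      - 2 * PS β H i x * PS β Hᶜ i x * bval (d i) := by ring
  rw [e, this]
  ring

lemma Q_anti (hm : 0 < m) (β : ι → Fin m) (H : Finset ι) (r : ℕ) (hr : 0 < r)
    (hH : ∀ i, r ≤ (univ.filter (fun j => β j = i ∧ j ∈ H)).card)
    (hH' : ∀ i, r ≤ (univ.filter (fun j => β j = i ∧ j ∈ Hᶜ)).card) (t v b : ℝ) (ht : 0 < t)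
    (hv : 0 ≤ v) :
    pr (fun x => b < QQ β x ∧ QQ β x < b + v) ≤
      4 * (2 * t + 1) / √r + (v * m / (2 * t ^ 2) + 1) / √(m / 2) := by
  classical
  have hm' : (0:ℝ) < m := by exact_mod_cast hm
  set B : ℝ := (v * m / (2 * t ^ 2) + 1) / √(m / 2) with hB
  have hB0 : 0 ≤ B := by positivity
  set bad : (ι → Bool) → ℝ := fun x => ∑ i, (ind (|PS β H i x| < t) + ind (|PS β Hᶜ i x| < t))
    with hbad
  have hbad0 : ∀ x, 0 ≤ bad x := fun x => sum_nonneg fun i _ =>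
    add_nonneg (ind_nonneg _) (ind_nonneg _)
  have hpt : ∀ x, E (fun d => ind (b < QQ β (flip (pat β H d) x) ∧
      QQ β (flip (pat β H d) x) < b + v)) ≤ 2 / m * bad x + B := by
    intro x
    set S : Finset (Fin m) := univ.filter (fun i => t ≤ |PS β H i x| ∧ t ≤ |PS β Hᶜ i x|) with hS
    by_cases hc : (m:ℝ) / 2 ≤ S.card
    · have hpos : 0 < S.card := by
        have : (0:ℝ) < S.card := lt_of_lt_of_le (by positivity) hc
        exact_mod_cast this
      have h := lo (fun i => - 2 * PS β H i x * PS β Hᶜ i x / m)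
        (∑ i, (PS β H i x ^ 2 + PS β Hᶜ i x ^ 2) / m) b (2 * t ^ 2 / m) v (by positivity) hv S
        hpos (by
          intro i hi
          simp only [hS, mem_filter, mem_univ, true_and] at hi
          rw [abs_div, abs_mul, abs_mul, abs_of_pos hm']
          have := mul_le_mul hi.1 hi.2 ht.le (abs_nonneg _)
          rw [abs_neg, abs_two]
          apply div_le_div_of_nonneg_right _ hm'.le
          nlinarith)
      have h2 : E (fun d => ind (b < QQ β (flip (pat β H d) x) ∧
          QQ β (flip (pat β H d) x) < b + v)) ≤ B := by
        simp only [QQ_flip]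
        refine h.trans ?_
        rw [hB]
        have e : v / (2 * t ^ 2 / m) = v * m / (2 * t ^ 2) := by field_simp
        rw [e]
        gcongr
      have := hbad0 x
      have : 0 ≤ 2 / m * bad x := by positivity
      linarith
    · rw [not_le] at hc
      have h1 : (m:ℝ) ≤ bad x + S.card := by
        have : (S.card : ℝ) = ∑ i : Fin m, ind (t ≤ |PS β H i x| ∧ t ≤ |PS β Hᶜ i x|) := by
          rw [sum_ind, hS]
          congr
        rw [this, hbad]
        dsimp only
        rw [← sum_add_distrib]
        have h3 : (m:ℝ) = ∑ i : Fin m, (1:ℝ) := by simp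
        conv_lhs => rw [h3]
        refine sum_le_sum fun i _ => ?_
        by_cases ha : |PS β H i x| < t
        · rw [ind_pos ha]
          have := ind_nonneg (|PS β Hᶜ i x| < t)
          have := ind_nonneg (t ≤ |PS β H i x| ∧ t ≤ |PS β Hᶜ i x|)
          linarith
        · by_cases hb : |PS β Hᶜ i x| < t
          · rw [ind_pos hb]
            have := ind_nonneg (|PS β H i x| < t)
            have := ind_nonneg (t ≤ |PS β H i x| ∧ t ≤ |PS β Hᶜ i x|)
            linarith
          · rw [ind_neg ha, ind_neg hb, ind_pos ⟨not_lt.1 ha, not_lt.1 hb⟩]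
            norm_num
      have h2 : 1 ≤ 2 / m * bad x := by
        rw [div_mul_eq_mul_div, le_div_iff₀ hm']
        linarith
      have h3 := pr_le_one (fun d => b < QQ β (flip (pat β H d) x) ∧
          QQ β (flip (pat β H d) x) < b + v)
      unfold pr at h3
      linarith
  unfold pr
  rw [E_avg (pat β H)]
  refine (E_mono hpt).trans ?_
  rw [E_add, E_const, E_mul_left]
  gcongr
  rw [hbad, E_sum]
  have h4 : ∀ i ∈ (univ : Finset (Fin m)),
      E (fun x => ind (|PS β H i x| < t) + ind (|PS β Hᶜ i x| < t)) ≤ 2 * ((2 * t + 1) / √r) := by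
    intro i _
    rw [E_add]
    have h5 := PS_anti β H i r hr (hH i) t ht
    have h6 := PS_anti β Hᶜ i r hr (hH' i) t ht
    unfold pr at h5 h6
    linarith
  have h7 := sum_le_sum h4
  rw [sum_const, card_univ, Fintype.card_fin, nsmul_eq_mul] at h7
  calc _ ≤ 2 / m * (m * (2 * ((2 * t + 1) / √r))) := by gcongr
    _ = _ := by field_simp; ring

lemma exists_halfset (hm : 2 ≤ m) (β : ι → Fin m)
    (hβ : ∀ i, (univ.filter (fun j => β j = i)).card = m) :
    ∃ H : Finset ι, (∀ i, m / 2 ≤ (univ.filter (fun j => β j = i ∧ j ∈ H)).card) ∧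
      (∀ i, m / 2 ≤ (univ.filter (fun j => β j = i ∧ j ∈ Hᶜ)).card) := by
  have h1 : ∀ i, ∃ S ⊆ univ.filter (fun j => β j = i), S.card = m / 2 := by
    intro i
    apply exists_subset_card_eq
    rw [hβ]; omega
  choose S hS hc using h1
  have h2 : ∀ i, univ.filter (fun j => β j = i ∧ j ∈ univ.biUnion S) = S i := by
    intro i
    ext j
    simp only [mem_filter, mem_univ, true_and, mem_biUnion]
    constructor
    · rintro ⟨h, i', hi'⟩
      have := hS i' hi'
      simp only [mem_filter, mem_univ, true_and] at this
      rw [← h, this]; exact hi'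
    · intro h
      have := hS i h
      simp only [mem_filter, mem_univ, true_and] at this
      exact ⟨this, i, h⟩
  refine ⟨univ.biUnion S, fun i => by rw [h2, hc], fun i => ?_⟩
  have h3 : univ.filter (fun j => β j = i ∧ j ∈ (univ.biUnion S)ᶜ) =
      univ.filter (fun j => β j = i) \ univ.filter (fun j => β j = i ∧ j ∈ univ.biUnion S) := by
    ext j
    simp only [mem_filter, mem_univ, true_and, mem_compl, mem_sdiff]
    tauto
  rw [h3, h2, card_sdiff_of_subset (hS i), hc, hβ]
  omega

end quad
end HS

namespace HS

open Finset

section final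
variable {ι : Type*} [Fintype ι] [DecidableEq ι] {m : ℕ}

/-- Same block, different index. -/
def nb (β : ι → Fin m) (j l : ι) : Prop := β l = β j ∧ l ≠ j

lemma Der_lin (a : ι → ℝ) (j : ι) (x : ι → Bool) :
    Der j (fun y => ∑ i, a i * bval (y i)) x = a j := by
  unfold Der
  rw [← sum_sub_distrib, sum_eq_single j]
  · simp [bval]
  · intro l _ hl
    rw [Function.update_of_ne hl, Function.update_of_ne hl]; ring
  · simp

open Classical in
lemma U_update (β : ι → Fin m) (i : Fin m) (j : ι) (x : ι → Bool) (c : Bool) :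
    U β i (Function.update x j c) = (if β j = i then bval c else 0) +
      ∑ l, if β l = i ∧ l ≠ j then bval (x l) else 0 := by
  unfold U
  rw [← sum_erase_add _ _ (mem_univ j), add_comm, Function.update_self]
  congr 1
  rw [← sum_erase_add _ _ (mem_univ j)]
  simp only [ne_eq, not_true_eq_false, and_false, if_false, add_zero]
  refine sum_congr rfl fun l hl => ?_
  have hl' : l ≠ j := ne_of_mem_erase hl
  rw [Function.update_of_ne hl']
  simp [hl']

open Classical in
lemma Der_QQ (β : ι → Fin m) (j : ι) (x : ι → Bool) :
    Der j (QQ β) x = ∑ l, (2 / m * (if nb β j l then (1:ℝ) else 0)) * bval (x l) := by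
  unfold Der QQ
  rw [← sum_sub_distrib, sum_eq_single (β j)]
  · simp only [U_update, if_true]
    have : ∑ l, (2 / m * (if nb β j l then (1:ℝ) else 0)) * bval (x l) =
        2 / m * ∑ l, if β l = β j ∧ l ≠ j then bval (x l) else 0 := by
      rw [mul_sum]
      refine sum_congr rfl fun l _ => ?_
      by_cases h : β l = β j ∧ l ≠ j <;> simp [nb, h]
    rw [this]
    simp only [bval, if_true, Bool.false_eq_true, if_false]
    ring
  · intro i _ hi
    simp only [U_update, if_neg hi.symm]
    ring
  · simp

open Classical in
lemma E_q_sq (hm : 0 < m) (β : ι → Fin m)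
    (hβ : ∀ i, (univ.filter (fun j => β j = i)).card = m) (j : ι) :
    E (fun x => Der j (QQ β) x ^ 2) ≤ 4 / m := by
  have hm' : (0:ℝ) < m := by exact_mod_cast hm
  simp only [Der_QQ]
  rw [E_lin_sq]
  have : ∀ l ∈ (univ : Finset ι), (2 / m * (if nb β j l then (1:ℝ) else 0)) ^ 2 ≤
      4 / m ^ 2 * (if β l = β j then (1:ℝ) else 0) := by
    intro l _
    by_cases h : β l = β j
    · by_cases h2 : l ≠ j
      · simp [nb, h, h2]; apply le_of_eq; ring
      · simp [nb, h, h2]; positivity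
    · simp [nb, h]
  refine (sum_le_sum this).trans ?_
  rw [← mul_sum, sum_boole, hβ]
  apply le_of_eq
  field_simp

lemma E_q_abs (hm : 0 < m) (β : ι → Fin m)
    (hβ : ∀ i, (univ.filter (fun j => β j = i)).card = m) (j : ι) :
    E (fun x => |Der j (QQ β) x|) ≤ 2 / √m := by
  refine (E_abs_le _).trans ?_
  refine (Real.sqrt_le_sqrt (E_q_sq hm β hβ j)).trans ?_
  rw [Real.sqrt_div (by norm_num)]
  rw [show (4:ℝ) = 2 ^ 2 by norm_num, Real.sqrt_sq (by norm_num)]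

open Classical in
lemma E_lin_q (hm : 0 < m) (β : ι → Fin m)
    (hβ : ∀ i, (univ.filter (fun j => β j = i)).card = m) (a : ι → ℝ) (T : Finset ι) :
    E (fun x => |∑ j ∈ T, a j * Der j (QQ β) x|) ≤ 2 * √(∑ j ∈ T, a j ^ 2) := by
  have hm' : (0:ℝ) < m := by exact_mod_cast hm
  refine (E_abs_le _).trans ?_
  have h1 : ∀ x, ∑ j ∈ T, a j * Der j (QQ β) x =
      ∑ l, (∑ j ∈ T, a j * (2 / m * (if nb β j l then (1:ℝ) else 0))) * bval (x l) := by
    intro x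
    simp only [Der_QQ, mul_sum, sum_mul]
    rw [sum_comm]
    refine sum_congr rfl fun l _ => sum_congr rfl fun j _ => by ring
  simp only [h1]
  rw [E_lin_sq]
  have h2 : ∀ l ∈ (univ : Finset ι), (∑ j ∈ T, a j * (2 / m * (if nb β j l then (1:ℝ) else 0))) ^ 2
      ≤ 4 / m * ∑ j ∈ T, a j ^ 2 * (if β l = β j then (1:ℝ) else 0) := by
    intro l _
    have e : ∑ j ∈ T, a j * (2 / m * (if nb β j l then (1:ℝ) else 0)) = 2 / m *
        ∑ j ∈ T, (a j * (if β l = β j then (1:ℝ) else 0)) * (if nb β j l then (1:ℝ) else 0) := by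
      rw [mul_sum]
      refine sum_congr rfl fun j _ => ?_
      by_cases h : β l = β j <;> simp [nb, h]
      split_ifs <;> ring
    rw [e, mul_pow]
    have cs := sum_mul_sq_le_sq_mul_sq T (fun j => a j * (if β l = β j then (1:ℝ) else 0))
      (fun j => if nb β j l then (1:ℝ) else 0)
    have e2 : ∑ j ∈ T, (a j * (if β l = β j then (1:ℝ) else 0)) ^ 2 =
        ∑ j ∈ T, a j ^ 2 * (if β l = β j then (1:ℝ) else 0) := by
      refine sum_congr rfl fun j _ => ?_
      split_ifs <;> ring
    have e3 : ∑ j ∈ T, (if nb β j l then (1:ℝ) else 0) ^ 2 ≤ m := by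
      calc _ ≤ ∑ j ∈ T, (if β j = β l then (1:ℝ) else 0) := by
            refine sum_le_sum fun j _ => ?_
            by_cases h : β l = β j
            · by_cases h2 : l ≠ j <;> simp [nb, h, h2]
            · simp [nb, h, Ne.symm h]
        _ ≤ ∑ j, (if β j = β l then (1:ℝ) else 0) := by
            apply sum_le_sum_of_subset_of_nonneg (subset_univ _)
            intro j _ _; split_ifs <;> norm_num
        _ = m := by rw [sum_boole, hβ]
    rw [e2] at cs
    have h0 : 0 ≤ ∑ j ∈ T, a j ^ 2 * (if β l = β j then (1:ℝ) else 0) :=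
      sum_nonneg fun j _ => by positivity
    calc _ ≤ (2 / (m:ℝ)) ^ 2 * ((∑ j ∈ T, a j ^ 2 * (if β l = β j then (1:ℝ) else 0)) * m) := by
          gcongr
          exact cs.trans (by gcongr)
      _ = _ := by field_simp; ring
  have h3 := sum_le_sum h2
  rw [← mul_sum, sum_comm] at h3
  have h4 : ∑ j ∈ T, ∑ l, a j ^ 2 * (if β l = β j then (1:ℝ) else 0) = m * ∑ j ∈ T, a j ^ 2 := by
    rw [mul_sum]
    refine sum_congr rfl fun j _ => ?_
    rw [← mul_sum, sum_boole, hβ]; ring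
  rw [h4] at h3
  refine (Real.sqrt_le_sqrt h3).trans ?_
  have : 4 / (m:ℝ) * (m * ∑ j ∈ T, a j ^ 2) = 2 ^ 2 * ∑ j ∈ T, a j ^ 2 := by
    field_simp; ring
  rw [this, Real.sqrt_mul (by norm_num), Real.sqrt_sq (by norm_num)]

lemma pt_bound {C : ℝ} {D : ℝ → ℝ} (hC1 : 1 ≤ C) (hD : ∀ z, |D z| ≤ C)
    (hL : ∀ u u', |Real.smoothTransition u - Real.smoothTransition u'| ≤ C * |u - u'|)
    (hS : ∀ u h z, |z - u| ≤ |h| → |(Real.smoothTransition (u + h) -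
      Real.smoothTransition (u - h)) / 2 - h * D z| ≤ C * h ^ 2)
    (Q T : (ι → Bool) → ℝ) (a : ι → ℝ) (hT : ∀ j x, Der j T x = a j)
    (c v b w : ℝ) (hv : 0 < v) (hw : 0 < w) (tail : Finset ι) (x y : ι → Bool) :
    ∑ j, Der j (smo Q c v) x * Der j (smo T b w) y ≤
      ∑ j ∈ tailᶜ, C / v * |Der j Q x| + ∑ j ∈ tail, C ^ 2 / (v ^ 2 * w) * |a j| * Der j Q x ^ 2 +
      ∑ j ∈ tail, C ^ 2 / (v * w ^ 2) * a j ^ 2 * |Der j Q x| +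
      C ^ 2 / (v * w) * |∑ j ∈ tail, a j * Der j Q x| := by
  rw [← sum_compl_add_sum tail]
  have h1 : ∑ j ∈ tailᶜ, Der j (smo Q c v) x * Der j (smo T b w) y ≤
      ∑ j ∈ tailᶜ, C / v * |Der j Q x| := by
    refine sum_le_sum fun j _ => ?_
    refine (le_abs_self _).trans ?_
    rw [abs_mul]
    have := smo_der1 hL Q c v hv j x
    calc _ ≤ (C * |Der j Q x| / v) * 1 := by
          apply mul_le_mul this (abs_Der_smo_le_one _ _ _ _ _) (abs_nonneg _); positivity
      _ = _ := by ring
  set d1 := D ((c + v - Q x) / v) with hd1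
  set d2 := D ((b + w - T y) / w) with hd2
  have h2 : ∀ j ∈ tail, Der j (smo Q c v) x * Der j (smo T b w) y ≤
      C ^ 2 / (v ^ 2 * w) * |a j| * Der j Q x ^ 2 +
      C ^ 2 / (v * w ^ 2) * a j ^ 2 * |Der j Q x| + d1 * d2 / (v * w) * (a j * Der j Q x) := by
    intro j _
    have a1 := smo_der2 hS Q c v hv j x
    have a2 := smo_der2 hS T b w hw j y
    have a3 := smo_der1 hL T b w hw j y
    rw [hT] at a2 a3
    rw [← hd1] at a1
    rw [← hd2] at a2
    set f := Der j (smo Q c v) x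
    set g := Der j (smo T b w) y
    set q := Der j Q x
    have e : f * g = (f + q / v * d1) * g - q / v * d1 * (g + a j / w * d2) +
      d1 * d2 / (v * w) * (a j * q) := by
      field_simp; ring
    rw [e]
    have b1 : (f + q / v * d1) * g ≤ C ^ 2 / (v ^ 2 * w) * |a j| * q ^ 2 := by
      refine (le_abs_self _).trans ?_
      rw [abs_mul]
      calc _ ≤ (C * q ^ 2 / v ^ 2) * (C * |a j| / w) := by
            apply mul_le_mul a1 a3 (abs_nonneg _); positivity
        _ = _ := by field_simp
    have b2 : - (q / v * d1 * (g + a j / w * d2)) ≤ C ^ 2 / (v * w ^ 2) * a j ^ 2 * |q| := by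
      refine (neg_le_abs _).trans ?_
      rw [abs_mul, abs_mul, abs_div, abs_of_pos hv]
      calc _ ≤ (|q| / v * C) * (C * a j ^ 2 / w ^ 2) := by
            apply mul_le_mul _ a2 (abs_nonneg _); positivity
            gcongr
            exact hD _
        _ = _ := by field_simp
    linarith
  have h3 := sum_le_sum h2
  rw [sum_add_distrib, sum_add_distrib, ← mul_sum] at h3
  have h4 : d1 * d2 / (v * w) * ∑ j ∈ tail, a j * Der j Q x ≤
      C ^ 2 / (v * w) * |∑ j ∈ tail, a j * Der j Q x| := by
    refine (le_abs_self _).trans ?_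
    rw [abs_mul, abs_div, abs_mul, abs_of_pos (mul_pos hv hw)]
    have : |d1| * |d2| ≤ C ^ 2 := by
      rw [sq]; exact mul_le_mul (hD _) (hD _) (abs_nonneg _) (by linarith)
    gcongr
  linarith

lemma cov_smooth_bound {C : ℝ} {D : ℝ → ℝ} (hC1 : 1 ≤ C) (hD : ∀ z, |D z| ≤ C)
    (hL : ∀ u u', |Real.smoothTransition u - Real.smoothTransition u'| ≤ C * |u - u'|)
    (hS : ∀ u h z, |z - u| ≤ |h| → |(Real.smoothTransition (u + h) -
      Real.smoothTransition (u - h)) / 2 - h * D z| ≤ C * h ^ 2)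
    (hm : 0 < m) (β : ι → Fin m)
    (hβ : ∀ i, (univ.filter (fun j => β j = i)).card = m) (hcard : Fintype.card ι = m * m)
    (a : ι → ℝ)
    (c v b w : ℝ) (hv : 0 < v) (hw : 0 < w) (tail : Finset ι) (k : ℕ) (hk : tailᶜ.card ≤ k)
    (A : ℝ) (hA : √(∑ j ∈ tail, a j ^ 2) ≤ w * A) :
    E (fun x => smo (QQ β) c v x * smo (fun y => ∑ i, a i * bval (y i)) b w x) -
      E (smo (QQ β) c v) * E (smo (fun y => ∑ i, a i * bval (y i)) b w) ≤
      2 * C * k / (v * √m) + 4 * C ^ 2 * A / v ^ 2 + 2 * C ^ 2 * A ^ 2 / (v * √m) +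
        2 * C ^ 2 * A / v := by
  have hm' : (0:ℝ) < m := by exact_mod_cast hm
  have hsm : 0 < √(m:ℝ) := Real.sqrt_pos.2 hm'
  set N := √(∑ j ∈ tail, a j ^ 2) with hN
  have hN0 : 0 ≤ N := Real.sqrt_nonneg _
  have hA0 : 0 ≤ A := by
    by_contra h
    nlinarith [mul_pos hw (neg_pos.2 (not_le.1 h))]
  have hNs : ∑ j ∈ tail, a j ^ 2 = N ^ 2 := by
    rw [hN, Real.sq_sqrt (sum_nonneg fun j _ => sq_nonneg _)]
  refine (cov_le _ _ _ (fun x y => pt_bound hC1 hD hL hS (QQ β) _ a (Der_lin a) c v b w hv hw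
    tail x y)).trans ?_
  rw [E_add, E_add, E_add, E_sum, E_sum, E_sum, E_mul_left]
  simp only [E_mul_left]
  have t1 : ∑ j ∈ tailᶜ, C / v * E (fun x => |Der j (QQ β) x|) ≤ 2 * C * k / (v * √m) := by
    calc _ ≤ ∑ j ∈ tailᶜ, C / v * (2 / √m) := by
          gcongr with j; exact E_q_abs hm β hβ j
      _ = tailᶜ.card * (C / v * (2 / √m)) := by rw [sum_const, nsmul_eq_mul]
      _ ≤ k * (C / v * (2 / √m)) := by gcongr
      _ = _ := by field_simp
  have habs : ∑ j ∈ tail, |a j| ≤ m * N := by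
    have cs := sum_mul_sq_le_sq_mul_sq tail (fun j => |a j|) (fun _ => (1:ℝ))
    simp only [mul_one, sq_abs, one_pow, sum_const, nsmul_eq_mul] at cs
    rw [hNs] at cs
    have hc : (tail.card : ℝ) ≤ m * m := by
      have := card_le_univ tail
      rw [hcard] at this
      exact_mod_cast this
    apply abs_le_of_sq_le_sq' _ (by positivity) |>.2
    calc _ ≤ N ^ 2 * tail.card := cs
      _ ≤ N ^ 2 * (m * m) := by gcongr
      _ = _ := by ring
  have t2 : ∑ j ∈ tail, C ^ 2 / (v ^ 2 * w) * |a j| * E (fun x => Der j (QQ β) x ^ 2) ≤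
      4 * C ^ 2 * A / v ^ 2 := by
    calc _ ≤ ∑ j ∈ tail, C ^ 2 / (v ^ 2 * w) * |a j| * (4 / m) := by
          gcongr with j; exact E_q_sq hm β hβ j
      _ = C ^ 2 / (v ^ 2 * w) * (4 / m) * ∑ j ∈ tail, |a j| := by
          rw [mul_sum]; refine sum_congr rfl fun j _ => by ring
      _ ≤ C ^ 2 / (v ^ 2 * w) * (4 / m) * (m * (w * A)) := by
          gcongr; exact habs.trans (by gcongr)
      _ = _ := by field_simp
  have t3 : ∑ j ∈ tail, C ^ 2 / (v * w ^ 2) * a j ^ 2 * E (fun x => |Der j (QQ β) x|) ≤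
      2 * C ^ 2 * A ^ 2 / (v * √m) := by
    calc _ ≤ ∑ j ∈ tail, C ^ 2 / (v * w ^ 2) * a j ^ 2 * (2 / √m) := by
          gcongr with j; exact E_q_abs hm β hβ j
      _ = C ^ 2 / (v * w ^ 2) * (2 / √m) * ∑ j ∈ tail, a j ^ 2 := by
          rw [mul_sum]; refine sum_congr rfl fun j _ => by ring
      _ ≤ C ^ 2 / (v * w ^ 2) * (2 / √m) * (w * A) ^ 2 := by
          rw [hNs]; gcongr
      _ = _ := by field_simp
  have t4 : C ^ 2 / (v * w) * E (fun x => |∑ j ∈ tail, a j * Der j (QQ β) x|) ≤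
      2 * C ^ 2 * A / v := by
    calc _ ≤ C ^ 2 / (v * w) * (2 * (w * A)) := by
          gcongr
          exact (E_lin_q hm β hβ a tail).trans (by gcongr)
      _ = _ := by field_simp
  linarith

/-- Passing from indicators to smoothed indicators. -/
lemma cov_ind_le (F G f g : (ι → Bool) → ℝ) (p q : (ι → Bool) → ℝ)
    (hF : ∀ x, |F x - f x| ≤ p x) (hG : ∀ x, |G x - g x| ≤ q x)
    (hF0 : ∀ x, 0 ≤ F x) (hF1 : ∀ x, F x ≤ 1)
    (hf0 : ∀ x, 0 ≤ f x) (hf1 : ∀ x, f x ≤ 1)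
    (hG0 : ∀ x, 0 ≤ G x) (hG1 : ∀ x, G x ≤ 1) (hg0 : ∀ x, 0 ≤ g x) (hg1 : ∀ x, g x ≤ 1) :
    E (fun x => F x * G x) - E F * E G ≤
      (E (fun x => f x * g x) - E f * E g) + 2 * E p + 2 * E q := by
  have h1 : E (fun x => F x * G x) ≤ E (fun x => f x * g x) + E p + E q := by
    rw [← E_add, ← E_add]
    apply E_mono
    intro x
    have a1 := abs_le.1 (hF x)
    have a2 := abs_le.1 (hG x)
    have : F x * G x = f x * g x + (F x - f x) * G x + f x * (G x - g x) := by ring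
    nlinarith [mul_le_mul_of_nonneg_right a1.2 (hG0 x), mul_le_mul_of_nonneg_left a2.2 (hf0 x),
      mul_le_mul_of_nonneg_left (hG1 x) ((abs_nonneg _).trans (hF x)),
      mul_le_mul_of_nonneg_right (hf1 x) ((abs_nonneg _).trans (hG x))]
  have h2 : E f ≤ E F + E p := by
    rw [← E_add]; apply E_mono; intro x; have := abs_le.1 (hF x); linarith
  have h3 : E g ≤ E G + E q := by
    rw [← E_add]; apply E_mono; intro x; have := abs_le.1 (hG x); linarith
  have b1 : 0 ≤ E p := E_nonneg fun x => (abs_nonneg _).trans (hF x)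
  have b2 : 0 ≤ E q := E_nonneg fun x => (abs_nonneg _).trans (hG x)
  have b3 : 0 ≤ E g := E_nonneg hg0
  have b4 : 0 ≤ E F := E_nonneg hF0
  have b5 : E g ≤ 1 := by
    have := E_mono hg1; rwa [E_const] at this
  have b6 : E F ≤ 1 := by
    have := E_mono hF1; rwa [E_const] at this
  have h4 : E f * E g ≤ E F * E G + E p + E q := by
    nlinarith [mul_le_mul_of_nonneg_right h2 b3, mul_le_mul_of_nonneg_left h3 b4,
      mul_le_mul_of_nonneg_left b5 b1, mul_le_mul_of_nonneg_right b6 b2]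
  linarith

end final
end HS

namespace HS

open Finset

section concl
variable {ι : Type*} [Fintype ι] [DecidableEq ι] {m : ℕ}

lemma pow_quot {s : ℝ} (hs : 1 ≤ s) {p q : ℕ} (h : p + 1 ≤ q) : s ^ p / s ^ q ≤ 1 / s := by
  have h0 : 0 < s := by linarith
  rw [div_le_div_iff₀ (by positivity) h0, one_mul, ← pow_succ]
  exact pow_le_pow_right₀ hs h

lemma main_bound {C : ℝ} {D : ℝ → ℝ} (hC1 : 1 ≤ C) (hD : ∀ z, |D z| ≤ C)
    (hL : ∀ u u', |Real.smoothTransition u - Real.smoothTransition u'| ≤ C * |u - u'|)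
    (hS : ∀ u h z, |z - u| ≤ |h| → |(Real.smoothTransition (u + h) -
      Real.smoothTransition (u - h)) / 2 - h * D z| ≤ C * h ^ 2)
    (hm : 2 ≤ m) (β : ι → Fin m)
    (hβ : ∀ i, (univ.filter (fun j => β j = i)).card = m) (hcard : Fintype.card ι = m * m)
    (a : ι → ℝ) (b : ℝ) (s : ℝ) (hs : 1 ≤ s) (hsm : (m:ℝ) = s ^ 200) :
    E (fun x => ind (QQ β x ≤ m) * ind (∑ i, a i * bval (x i) ≤ b)) -
      E (fun x => ind (QQ β x ≤ m)) * E (fun x => ind (∑ i, a i * bval (x i) ≤ b)) ≤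
      (4 * C + 1008 * C ^ 2 + 60) * (1 / s) := by
  have h0 : 0 < s := by linarith
  have hmR : (2:ℝ) ≤ m := by exact_mod_cast hm
  have hsq : √(m:ℝ) = s ^ 100 := by
    rw [hsm, show s ^ 200 = (s ^ 100) ^ 2 by ring, Real.sqrt_sq (by positivity)]
  -- the cutoff
  set k : ℕ := ⌈s ^ 50⌉₊ with hk
  have hk1 : s ^ 50 ≤ k := Nat.le_ceil _
  have h50 : 1 ≤ s ^ 50 := one_le_pow₀ hs
  have hk2 : (k:ℝ) ≤ 2 * s ^ 50 := by
    have := Nat.ceil_lt_add_one (a := s ^ 50) (by positivity)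
    linarith
  have hk0 : 0 < k := by
    have : (0:ℝ) < k := by linarith
    exact_mod_cast this
  obtain ⟨tail, w, hw, htk, htail, hpr⟩ := half_lemma a b k hk0 (s ^ 2) (by positivity)
  -- logarithm
  have hlog : √(1 + Real.log (Fintype.card ι)) ≤ 21 * s ^ 2 := by
    apply Real.sqrt_le_iff.2 ⟨by positivity, ?_⟩
    rw [hcard]
    push_cast
    rw [hsm, ← pow_add, Real.log_pow]
    push_cast
    have h1 := Real.log_le_sub_one_of_pos h0
    have h2 : s ≤ s ^ 4 := le_self_pow₀ hs (by norm_num)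
    have h3 : (21 * s ^ 2) ^ 2 = 441 * s ^ 4 := by ring
    rw [h3]
    linarith
  have hA : √(∑ j ∈ tail, a j ^ 2) ≤ w * (21 * s ^ 4) := by
    refine htail.trans ?_
    calc _ ≤ w * s ^ 2 * (21 * s ^ 2) := by gcongr
      _ = _ := by ring
  have hcov := cov_smooth_bound hC1 hD hL hS (by omega) β hβ hcard a m (s ^ 20) b w
    (by positivity) hw tail k htk _ hA
  obtain ⟨H, hH, hH'⟩ := exists_halfset hm β hβ
  have hQ := Q_anti (by omega) β H (m / 2) (by omega) hH hH' (s ^ 98) (s ^ 20) m (by positivity)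
    (by positivity)
  have key := cov_ind_le (fun x => ind (QQ β x ≤ m)) (fun x => ind (∑ i, a i * bval (x i) ≤ b))
    (smo (QQ β) m (s ^ 20)) (smo (fun y => ∑ i, a i * bval (y i)) b w)
    (fun x => ind ((m:ℝ) < QQ β x ∧ QQ β x < m + s ^ 20))
    (fun x => ind (b < ∑ i, a i * bval (x i) ∧ ∑ i, a i * bval (x i) < b + w))
    (fun x => smo_approx (QQ β) m (s ^ 20) (by positivity) x)
    (fun x => smo_approx (fun y => ∑ i, a i * bval (y i)) b w hw x)
    (fun _ => ind_nonneg _) (fun _ => ind_le_one _) (fun _ => smo_nonneg _ _ _ _)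
    (fun _ => smo_le_one _ _ _ _)
    (fun _ => ind_nonneg _) (fun _ => ind_le_one _) (fun _ => smo_nonneg _ _ _ _)
    (fun _ => smo_le_one _ _ _ _)
  unfold pr at hQ hpr
  refine key.trans ?_
  rw [hsq] at hcov
  -- individual terms
  have u1 : 2 * C * k / (s ^ 20 * s ^ 100) ≤ 4 * C * (1 / s) := by
    calc _ ≤ 2 * C * (2 * s ^ 50) / (s ^ 20 * s ^ 100) := by gcongr
      _ = 4 * C * (s ^ 50 / s ^ 120) := by rw [← pow_add]; ring
      _ ≤ _ := by
        have := pow_quot hs (p := 50) (q := 120) (by norm_num)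
        gcongr
  have u2 : 4 * C ^ 2 * (21 * s ^ 4) / (s ^ 20) ^ 2 ≤ 84 * C ^ 2 * (1 / s) := by
    calc _ = 84 * C ^ 2 * (s ^ 4 / s ^ 40) := by rw [← pow_mul]; ring
      _ ≤ _ := by
        have := pow_quot hs (p := 4) (q := 40) (by norm_num)
        gcongr
  have u3 : 2 * C ^ 2 * (21 * s ^ 4) ^ 2 / (s ^ 20 * s ^ 100) ≤ 882 * C ^ 2 * (1 / s) := by
    calc _ = 882 * C ^ 2 * (s ^ 8 / s ^ 120) := by rw [← pow_add, mul_pow, ← pow_mul]; ring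
      _ ≤ _ := by
        have := pow_quot hs (p := 8) (q := 120) (by norm_num)
        gcongr
  have u4 : 2 * C ^ 2 * (21 * s ^ 4) / s ^ 20 ≤ 42 * C ^ 2 * (1 / s) := by
    calc _ = 42 * C ^ 2 * (s ^ 4 / s ^ 20) := by ring
      _ ≤ _ := by
        have := pow_quot hs (p := 4) (q := 20) (by norm_num)
        gcongr
  have r1 : s ^ 100 / 2 ≤ √((m / 2 : ℕ):ℝ) := by
    apply Real.le_sqrt_of_sq_le
    have h3 : m ≤ 4 * (m / 2) := by omega
    have h4 : (m:ℝ) ≤ 4 * ((m / 2 : ℕ):ℝ) := by exact_mod_cast h3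
    have h5 : (s ^ 100 / 2) ^ 2 = s ^ 200 / 4 := by rw [div_pow, ← pow_mul]; norm_num
    rw [h5, ← hsm]; linarith
  have r2 : s ^ 100 / 2 ≤ √((m:ℝ) / 2) := by
    apply Real.le_sqrt_of_sq_le
    have h5 : (s ^ 100 / 2) ^ 2 = s ^ 200 / 4 := by rw [div_pow, ← pow_mul]; norm_num
    rw [h5, ← hsm]; linarith
  have u5 : 4 * (2 * s ^ 98 + 1) / √((m / 2 : ℕ):ℝ) ≤ 24 * (1 / s) := by
    have : 1 ≤ s ^ 98 := one_le_pow₀ hs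
    calc _ ≤ 4 * (3 * s ^ 98) / (s ^ 100 / 2) := by gcongr; linarith
      _ = 24 * (s ^ 98 / s ^ 100) := by field_simp; norm_num
      _ ≤ _ := by
        have := pow_quot hs (p := 98) (q := 100) (by norm_num)
        gcongr
  have u6 : (s ^ 20 * m / (2 * (s ^ 98) ^ 2) + 1) / √((m:ℝ) / 2) ≤ 4 * (1 / s) := by
    have h6 : s ^ 20 * m / (2 * (s ^ 98) ^ 2) = s ^ 24 / 2 := by
      rw [hsm, ← pow_mul, ← pow_add, div_eq_div_iff (by positivity) (by norm_num)]
      ring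
    have : 1 ≤ s ^ 24 := one_le_pow₀ hs
    rw [h6]
    calc _ ≤ (2 * s ^ 24) / (s ^ 100 / 2) := by gcongr; linarith
      _ = 4 * (s ^ 24 / s ^ 100) := by ring
      _ ≤ _ := by
        have := pow_quot hs (p := 24) (q := 100) (by norm_num)
        gcongr
  have u7 : 1 / √(k:ℝ) ≤ 1 / s := by
    apply one_div_le_one_div_of_le h0
    apply Real.le_sqrt_of_sq_le
    exact (pow_le_pow_right₀ hs (by norm_num)).trans hk1
  have u8 : 1 / s ^ 2 ≤ 1 / s := by
    apply one_div_le_one_div_of_le h0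
    exact le_self_pow₀ hs (by norm_num)
  linarith

end concl

lemma bExp_eq (n : ℕ) (f : (Fin n → Bool) → ℝ) : bExp n f = E f := by
  unfold bExp E
  rw [Fintype.card_fin]

lemma bCov_eq (n : ℕ) (f g : (Fin n → Bool) → ℝ) :
    bCov n f g = E (fun x => f x * g x) - E f * E g := by
  unfold bCov
  simp only [bExp_eq]
  have : ∀ x, (f x - E f) * (g x - E g) = f x * g x - E g * f x - E f * g x + E f * E g := by
    intro x; ring
  simp only [this]
  rw [E_add, E_sub, E_sub, E_mul_left, E_mul_left, E_const]
  ring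

/-- Block map. -/
def blk (m : ℕ) (j : Fin (m * m)) : Fin m :=
  ⟨(j : ℕ) / m, Nat.div_lt_of_lt_mul j.2⟩

lemma blk_card (m : ℕ) (i : Fin m) :
    (univ.filter (fun j => blk m j = i)).card = m := by
  have h : univ.filter (fun j => blk m j = i) =
      (univ : Finset (Fin m)).map ⟨fun l => finProdFinEquiv (i, l), by
        intro l l' h; simpa using h⟩ := by
    ext j
    obtain ⟨⟨p, q⟩, rfl⟩ := finProdFinEquiv.surjective j
    have : blk m (finProdFinEquiv (p, q)) = p := by
      ext
      have hm : 0 < m := lt_of_le_of_lt (Nat.zero_le _) p.2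
      simp [blk, finProdFinEquiv, Nat.add_mul_div_left _ _ hm, Nat.div_eq_of_lt q.2]
    simp only [mem_filter, mem_univ, true_and, this, mem_map]
    constructor
    · rintro rfl; exact ⟨q, rfl⟩
    · rintro ⟨w, hw⟩
      have h2 : (i, w) = (p, q) := finProdFinEquiv.injective hw
      exact (congrArg Prod.fst h2).symm
  rw [h]; simp

lemma Bm_eq (m : ℕ) : Bm m = {x | QQ (blk m) x ≤ m} := by
  unfold Bm QQ U
  ext x
  simp only [Set.mem_ofPred_eq, div_pow, Real.sq_sqrt (Nat.cast_nonneg m), blk, Fin.ext_iff]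

lemma indicator_eq {α : Type*} (p : α → Prop) :
    (Set.indicator {x | p x} 1 : α → ℝ) = fun x => ind (p x) := by
  classical
  ext x
  by_cases h : p x
  · rw [ind_pos h, Set.indicator_of_mem (by exact h)]; rfl
  · rw [ind_neg h, Set.indicator_of_notMem (by exact h)]

end HS

theorem stmt12 : ∃ C : ℝ, ∀ (m : ℕ), 1 ≤ m → ∀ (A : Set (Fin (m*m) → Bool)),
    IsHalfspaceB A →
    bCov (m*m) (Set.indicator (Bm m) 1) (Set.indicator A 1) ≤
      C * (m : ℝ) ^ (-(1:ℝ)/200) := by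
  obtain ⟨C, D, hC1, hD, hL, hS⟩ := HS.smooth_exists
  refine ⟨4 * C + 1008 * C ^ 2 + 60, ?_⟩
  rintro m hm A ⟨a, b, rfl⟩
  rw [HS.bCov_eq, HS.Bm_eq, HS.indicator_eq, HS.indicator_eq]
  have hm1 : (1:ℝ) ≤ m := by exact_mod_cast hm
  have hs : (1:ℝ) ≤ (m:ℝ) ^ ((1:ℝ)/200) := Real.one_le_rpow hm1 (by norm_num)
  have hsm : (m:ℝ) = ((m:ℝ) ^ ((1:ℝ)/200)) ^ 200 := by
    rw [← Real.rpow_natCast, ← Real.rpow_mul (by linarith)]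
    norm_num
  have hinv : (m:ℝ) ^ (-(1:ℝ)/200) = 1 / (m:ℝ) ^ ((1:ℝ)/200) := by
    rw [neg_div, Real.rpow_neg (by linarith), one_div ((m:ℝ) ^ _)]
  rw [hinv]
  rcases Nat.lt_or_ge m 2 with h | h
  · obtain rfl : m = 1 := by omega
    have h1 : HS.E (fun x => HS.ind (HS.QQ (HS.blk 1) x ≤ ((1:ℕ):ℝ)) *
        HS.ind (∑ i, a i * bval (x i) ≤ b)) ≤ 1 := by
      have := HS.E_mono (f := fun x => HS.ind (HS.QQ (HS.blk 1) x ≤ ((1:ℕ):ℝ)) *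
        HS.ind (∑ i, a i * bval (x i) ≤ b)) (g := fun _ => 1)
        (fun x => mul_le_one₀ (HS.ind_le_one _) (HS.ind_nonneg _) (HS.ind_le_one _))
      rwa [HS.E_const] at this
    have h2 : 0 ≤ HS.E (fun x => HS.ind (HS.QQ (HS.blk 1) x ≤ ((1:ℕ):ℝ))) :=
      HS.E_nonneg fun _ => HS.ind_nonneg _
    have h3 : 0 ≤ HS.E (fun x => HS.ind (∑ i : Fin (1*1), a i * bval (x i) ≤ b)) :=
      HS.E_nonneg fun _ => HS.ind_nonneg _
    have h4 := mul_nonneg h2 h3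
    rw [Nat.cast_one, Real.one_rpow]
    rw [Nat.cast_one] at h1 h4
    nlinarith [sq_nonneg C]
  · exact HS.main_bound hC1 hD hL hS h (HS.blk m) (HS.blk_card m) (by simp) a b _ hs hsm
end

section
/- Let f : {−1,1}^n → [0,1] and t > 0, and let s > 0 satisfy e^{−s} = 1 − e^{−t}. Then E_{Z∼μ_s}[ w₁(f_Z) ] ≥ (1 − e^{−t}) Σ_{S⊆{1,…,n}} |S| f̂(S)² e^{−2t(|S|−1)} ≥ (e^{2t} − e^{t}) Var(P_t f). -/
open Real

theorem sum_cube_prod {n : ℕ} {α : Type*} [Fintype α] (g : Fin n → α → ℝ) :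
    ∑ x : Fin n → α, ∏ i, g i (x i) = ∏ i, ∑ b, g i b := by
  classical
  rw [Finset.prod_univ_sum, Fintype.piFinset_univ]

theorem chi_eq {n : ℕ} (S : Finset (Fin n)) (x : Fin n → Bool) :
    chi n S x = ∏ i, if i ∈ S then bval (x i) else 1 := by
  unfold chi
  rw [Finset.prod_ite_mem, Finset.univ_inter]

theorem bExp_prod {n : ℕ} (g : Fin n → Bool → ℝ) :
    bExp n (fun x => ∏ i, g i (x i)) = ∏ i, (g i true + g i false) / 2 := by
  unfold bExp
  rw [sum_cube_prod, Finset.prod_div_distrib]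
  simp

theorem bExp_sum {n : ℕ} {ι : Type*} (A : Finset ι) (g : ι → (Fin n → Bool) → ℝ) :
    bExp n (fun x => ∑ k ∈ A, g k x) = ∑ k ∈ A, bExp n (g k) := by
  unfold bExp
  rw [Finset.sum_comm, Finset.sum_div]

theorem bExp_const_mul {n : ℕ} (c : ℝ) (g : (Fin n → Bool) → ℝ) :
    bExp n (fun x => c * g x) = c * bExp n g := by
  unfold bExp
  rw [← Finset.mul_sum, mul_div_assoc]

theorem bExp_chi_mul {n : ℕ} (S T : Finset (Fin n)) :
    bExp n (fun x => chi n S x * chi n T x) = if S = T then 1 else 0 := by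
  simp only [chi_eq, ← Finset.prod_mul_distrib]
  rw [bExp_prod (fun i b => (if i ∈ S then bval b else 1) * (if i ∈ T then bval b else 1))]
  split_ifs with h
  · subst h
    apply Finset.prod_eq_one
    intro i _
    by_cases hi : i ∈ S <;> simp [hi, bval]
  · have : ∃ i, ¬ (i ∈ S ↔ i ∈ T) := by
      by_contra hc
      push Not at hc
      exact h (Finset.ext hc)
    obtain ⟨i, hi⟩ := this
    apply Finset.prod_eq_zero (Finset.mem_univ i)
    by_cases h1 : i ∈ S <;> by_cases h2 : i ∈ T <;> simp_all [bval]

theorem sum_chi_chi {n : ℕ} (x y : Fin n → Bool) :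
    ∑ S : Finset (Fin n), chi n S y * chi n S x = if y = x then 2 ^ n else 0 := by
  simp only [chi, ← Finset.prod_mul_distrib]
  rw [← Finset.powerset_univ, ← Finset.prod_one_add]
  split_ifs with h
  · subst h
    have : ∀ i : Fin n, 1 + bval (y i) * bval (y i) = 2 := by
      intro i
      cases y i <;> norm_num [bval]
    simp [this]
  · obtain ⟨i, hi⟩ := Function.ne_iff.mp h
    apply Finset.prod_eq_zero (Finset.mem_univ i)
    cases h1 : y i <;> cases h2 : x i <;> simp_all [bval]

theorem inversion {n : ℕ} (f : (Fin n → Bool) → ℝ) (x : Fin n → Bool) :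
    f x = ∑ S : Finset (Fin n), fourierCoef n f S * chi n S x := by
  unfold fourierCoef bExp
  simp only [div_mul_eq_mul_div, Finset.sum_mul]
  rw [← Finset.sum_div, Finset.sum_comm]
  simp only [mul_assoc, ← Finset.mul_sum, sum_chi_chi]
  simp

theorem bExp_sq_sum {n : ℕ} (a : Finset (Fin n) → ℝ) :
    bExp n (fun x => (∑ S, a S * chi n S x) * (∑ S, a S * chi n S x)) = ∑ S, a S ^ 2 := by
  simp only [Finset.sum_mul_sum]
  rw [bExp_sum]
  apply Finset.sum_congr rfl
  intro S _
  rw [bExp_sum]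
  have : ∀ T, bExp n (fun x => a S * chi n S x * (a T * chi n T x))
      = a S * a T * (if S = T then 1 else 0) := by
    intro T
    rw [← bExp_chi_mul, ← bExp_const_mul]
    congr 1; ext x; ring
  simp only [this]
  simp [sq]

theorem bVar_sum {n : ℕ} (a : Finset (Fin n) → ℝ) :
    bVar n (fun x => ∑ S, a S * chi n S x) = ∑ S, if S = ∅ then 0 else a S ^ 2 := by
  have hm : bExp n (fun x => ∑ S, a S * chi n S x) = a ∅ := by
    rw [bExp_sum]
    have : ∀ S, bExp n (fun x => a S * chi n S x) = a S * (if S = ∅ then 1 else 0) := by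
      intro S
      rw [← bExp_chi_mul, ← bExp_const_mul]
      simp [chi]
    simp only [this]
    simp
  unfold bVar bCov
  rw [hm]
  have h2 : ∀ x, (∑ S, a S * chi n S x) - a ∅
      = ∑ S, (if S = ∅ then 0 else a S) * chi n S x := by
    intro x
    rw [sub_eq_iff_eq_add]
    have : a ∅ = ∑ S : Finset (Fin n), if S = ∅ then a S * chi n S x else 0 := by
      simp [chi]
    rw [this, ← Finset.sum_add_distrib]
    apply Finset.sum_congr rfl
    intro S _
    split_ifs <;> simp
  simp only [h2]
  rw [bExp_sq_sum]
  apply Finset.sum_congr rfl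
  intro S _
  split_ifs <;> simp

noncomputable def zval (o : Option Bool) : ℝ := o.elim 0 bval

noncomputable def kern {n : ℕ} (i : Fin n) (S : Finset (Fin n)) (j : Fin n) (o : Option Bool) : ℝ :=
  if j = i then (if j ∈ S ∧ o = none then 1 else 0) else (if j ∈ S then zval o else 1)

theorem coef_restrict {n : ℕ} (f : (Fin n → Bool) → ℝ) (z : Fin n → Option Bool) (i : Fin n) :
    fourierCoef n (restrictF f z) {i} = ∑ S, fourierCoef n f S * ∏ j, kern i S j (z j) := by
  have h1 : fourierCoef n (restrictF f z) {i}
      = bExp n (fun x => ∑ S, fourierCoef n f S * (chi n S (oslash z x) * chi n {i} x)) := by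
    unfold fourierCoef
    congr 1; ext x
    unfold restrictF
    rw [inversion f, Finset.sum_mul]
    apply Finset.sum_congr rfl
    intro S _
    rw [mul_assoc]; rfl
  rw [h1, bExp_sum]
  apply Finset.sum_congr rfl
  intro S _
  rw [bExp_const_mul]
  congr 1
  simp only [chi_eq, ← Finset.prod_mul_distrib, oslash]
  rw [bExp_prod (fun j b => (if j ∈ S then bval ((z j).getD b) else 1)
    * (if j ∈ ({i} : Finset (Fin n)) then bval b else 1))]
  apply Finset.prod_congr rfl
  intro j _
  unfold kern zval
  by_cases hj : j = i <;> by_cases hS : j ∈ S <;> rcases hz : z j with _ | b <;> simp_all [bval]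

theorem kern_corr {n : ℕ} (s q : ℝ) (hq : q ≠ 0) (hs : 1 - Real.exp (-s) = q)
    (i : Fin n) (S T : Finset (Fin n)) :
    ∑ z, muWeight n s z * ((∏ j, kern i S j (z j)) * ∏ j, kern i T j (z j)) =
      if S = T then (if i ∈ S then Real.exp (-s) / q * q ^ S.card else 0) else 0 := by
  unfold muWeight
  simp only [← Finset.prod_mul_distrib]
  rw [sum_cube_prod (fun j o => (if o = none then Real.exp (-s) else (1 - Real.exp (-s)) / 2)
    * (kern i S j o * kern i T j o))]
  simp only [Fintype.sum_option, Fintype.sum_bool]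
  rw [hs]
  have he : Real.exp (-s) = 1 - q := by linarith
  rw [he]
  simp only [reduceCtorEq, if_true, if_false]
  split_ifs with h hi
  · subst h
    have : ∀ j, (if j = i then (1 - q) / q else 1) * (if j ∈ S then q else 1) =
      (1 - q) * (kern i S j none * kern i S j none)
      + (q / 2 * (kern i S j (some true) * kern i S j (some true))
        + q / 2 * (kern i S j (some false) * kern i S j (some false))) := by
      intro j
      unfold kern zval
      by_cases hj : j = i
      · subst hj; simp [hi]; field_simp
      · by_cases hS : j ∈ S <;> simp [hj, hS, bval]
    simp only [← this]
    rw [Finset.prod_mul_distrib, Finset.prod_ite_eq', Finset.prod_ite_mem]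
    simp
  · apply Finset.prod_eq_zero (Finset.mem_univ i)
    simp [kern, hi]
  · have : ∃ i, ¬ (i ∈ S ↔ i ∈ T) := by
      by_contra hc
      push Not at hc
      exact h (Finset.ext hc)
    obtain ⟨j, hj⟩ := this
    apply Finset.prod_eq_zero (Finset.mem_univ j)
    unfold kern zval
    by_cases hji : j = i <;> by_cases h1 : j ∈ S <;> by_cases h2 : j ∈ T <;>
      simp_all [bval]

theorem restExp_w1 {n : ℕ} (f : (Fin n → Bool) → ℝ) (s q : ℝ) (hq : q ≠ 0)
    (hs : 1 - Real.exp (-s) = q) :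
    restExp n s (fun z => w1b n (restrictF f z)) =
      ∑ S : Finset (Fin n), (S.card : ℝ) * (fourierCoef n f S) ^ 2
        * (Real.exp (-s) / q * q ^ S.card) := by
  unfold restExp w1b
  simp only [coef_restrict]
  simp only [pow_two (∑ S, _), Finset.sum_mul_sum]
  simp only [Finset.mul_sum]
  rw [Finset.sum_comm]
  have key : ∀ i : Fin n, ∑ z : Fin n → Option Bool, ∑ S, ∑ T, muWeight n s z *
      (fourierCoef n f S * (∏ j, kern i S j (z j)) * (fourierCoef n f T * ∏ j, kern i T j (z j)))
      = ∑ S, if i ∈ S then (fourierCoef n f S) ^ 2 * (Real.exp (-s) / q * q ^ S.card) else 0 := by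
    intro i
    rw [Finset.sum_comm]
    apply Finset.sum_congr rfl
    intro S _
    rw [Finset.sum_comm]
    have : ∀ T, ∑ z : Fin n → Option Bool, muWeight n s z *
      (fourierCoef n f S * (∏ j, kern i S j (z j)) * (fourierCoef n f T * ∏ j, kern i T j (z j)))
      = fourierCoef n f S * fourierCoef n f T *
        (if S = T then (if i ∈ S then Real.exp (-s) / q * q ^ S.card else 0) else 0) := by
      intro T
      rw [← kern_corr s q hq hs, Finset.mul_sum]
      apply Finset.sum_congr rfl
      intro z _
      ring
    simp only [this]
    simp [sq]
  simp only [key]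
  rw [Finset.sum_comm]
  apply Finset.sum_congr rfl
  intro S _
  rw [Finset.sum_ite_mem]
  simp
  ring

theorem stmt16 (n : ℕ) (f : (Fin n → Bool) → ℝ) (t s : ℝ)
    (hf : ∀ x, f x ∈ Set.Icc (0:ℝ) 1) (ht : 0 < t) (hs : 0 < s)
    (hts : Real.exp (-s) = 1 - Real.exp (-t)) :
    restExp n s (fun z => w1b n (restrictF f z)) ≥
      (1 - Real.exp (-t)) * ∑ S : Finset (Fin n),
        (S.card : ℝ) * (fourierCoef n f S) ^ 2 * Real.exp (-2*t*((S.card : ℝ) - 1)) ∧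
    (1 - Real.exp (-t)) * ∑ S : Finset (Fin n),
        (S.card : ℝ) * (fourierCoef n f S) ^ 2 * Real.exp (-2*t*((S.card : ℝ) - 1)) ≥
      (Real.exp (2*t) - Real.exp t) * bVar n (bP n t f) := by
  have hq : 1 - Real.exp (-s) = Real.exp (-t) := by linarith
  have h1t : 0 ≤ 1 - Real.exp (-t) := by rw [← hts]; exact (Real.exp_pos _).le
  constructor
  · rw [restExp_w1 f s _ (Real.exp_pos _).ne' hq, ge_iff_le, Finset.mul_sum]
    apply Finset.sum_le_sum
    intro S _
    rcases Nat.eq_zero_or_pos S.card with h0 | h0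
    · simp [h0]
    · have hc : (1 : ℝ) ≤ S.card := by exact_mod_cast h0
      have e1 : Real.exp (-s) / Real.exp (-t) * Real.exp (-t) ^ S.card
          = (1 - Real.exp (-t)) * Real.exp (-t * ((S.card : ℝ) - 1)) := by
        rw [hts, ← Real.exp_nat_mul, div_mul_eq_mul_div, mul_div_assoc, ← Real.exp_sub]
        congr 2; ring
      rw [e1]
      have e2 : Real.exp (-2*t*((S.card : ℝ) - 1)) ≤ Real.exp (-t * ((S.card : ℝ) - 1)) := by
        apply Real.exp_le_exp.mpr
        nlinarith
      have h3 : 0 ≤ (1 - Real.exp (-t)) * ((S.card : ℝ) * fourierCoef n f S ^ 2) := by positivity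
      nlinarith [mul_le_mul_of_nonneg_left e2 h3]
  · unfold bP
    rw [bVar_sum (fun S => Real.exp (-t * S.card) * fourierCoef n f S)]
    have e0 : Real.exp (2*t) - Real.exp t = (1 - Real.exp (-t)) * Real.exp (2*t) := by
      rw [sub_mul, ← Real.exp_add]; ring_nf
    rw [e0, mul_assoc, ge_iff_le]
    apply mul_le_mul_of_nonneg_left _ h1t
    rw [Finset.mul_sum]
    apply Finset.sum_le_sum
    intro S _
    split_ifs with h
    · simp [h]
    · have hc : (1 : ℝ) ≤ S.card := by
        exact_mod_cast Finset.card_pos.mpr (Finset.nonempty_iff_ne_empty.mpr h)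
      have e3 : Real.exp (2*t) * (Real.exp (-t * S.card) * fourierCoef n f S) ^ 2
          = fourierCoef n f S ^ 2 * Real.exp (-2*t*((S.card : ℝ) - 1)) := by
        have : Real.exp (-2*t*((S.card : ℝ) - 1))
            = Real.exp (2*t) * (Real.exp (-t * S.card) * Real.exp (-t * S.card)) := by
          rw [← Real.exp_add, ← Real.exp_add]; congr 1; ring
        rw [this]; ring
      rw [e3, mul_assoc (S.card : ℝ)]
      have : 0 ≤ fourierCoef n f S ^ 2 * Real.exp (-2*t*((S.card : ℝ) - 1)) := by positivity
      exact le_mul_of_one_le_left this hc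
end

section
/- For m ≥ 1 let n = m², partition {1,…,n} into m consecutive blocks J_1,…,J_m of size m, and let B = { x ∈ ℝ^n : Σ_{i=1}^m ( m^{−1/2} Σ_{j∈J_i} x_j )² ≤ m }. Then for every half-space A ⊆ ℝ^n, Cov(1_A, 1_B) ≤ m^{−1/2}, where the covariance is with respect to the standard Gaussian measure γ_n. -/
open MeasureTheory Real

noncomputable def gauss (n : ℕ) : Measure (Fin n → ℝ) :=
  Measure.pi fun _ => ProbabilityTheory.gaussianReal 0 1

/-- Expectation with respect to the standard Gaussian measure on `ℝ^n`. -/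
noncomputable def gExp (n : ℕ) (f : (Fin n → ℝ) → ℝ) : ℝ := ∫ x, f x ∂(gauss n)

/-- Covariance with respect to the standard Gaussian measure on `ℝ^n`. -/
noncomputable def gCov (n : ℕ) (f g : (Fin n → ℝ) → ℝ) : ℝ :=
  gExp n (fun x => (f x - gExp n f) * (g x - gExp n g))

/-- Variance with respect to the standard Gaussian measure on `ℝ^n`. -/
noncomputable def gVar (n : ℕ) (f : (Fin n → ℝ) → ℝ) : ℝ := gCov n f f

/-- A half-space `{x : ⟨x, a⟩ ≤ b}` in `ℝ^n`. -/
def IsHalfspace {n : ℕ} (A : Set (Fin n → ℝ)) : Prop :=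
  ∃ (a : Fin n → ℝ) (b : ℝ), A = {x | ∑ i, x i * a i ≤ b}

/-- The Ornstein--Uhlenbeck semigroup `P_t`. -/
noncomputable def ou (n : ℕ) (t : ℝ) (f : (Fin n → ℝ) → ℝ) : (Fin n → ℝ) → ℝ :=
  fun x => ∫ y, f (fun i => Real.exp (-t) * x i + Real.sqrt (1 - Real.exp (-2*t)) * y i)
    ∂(gauss n)

/-- The shifted/rescaled function `f_{t,y}(x) = f(√(1-e^{-2t}) x + e^{-t} y)`. -/
noncomputable def shift (n : ℕ) (f : (Fin n → ℝ) → ℝ) (t : ℝ) (y : Fin n → ℝ) :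
    (Fin n → ℝ) → ℝ :=
  fun x => f (fun i => Real.sqrt (1 - Real.exp (-2*t)) * x i + Real.exp (-t) * y i)

/-- `M(g)`: the supremum over half-spaces `A` of `Cov(g, 1_A)`. -/
noncomputable def Mg (n : ℕ) (g : (Fin n → ℝ) → ℝ) : ℝ :=
  ⨆ A : {A : Set (Fin n → ℝ) // IsHalfspace A}, gCov n g (Set.indicator A.1 1)

/-- `w₁(f) = Σ_i (E[X_i f(X)])²`. -/
noncomputable def w1g (n : ℕ) (f : (Fin n → ℝ) → ℝ) : ℝ :=
  ∑ i : Fin n, (gExp n (fun x => x i * f x)) ^ 2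

open ProbabilityTheory in
theorem aux_cov {Ω : Type*} [MeasurableSpace Ω] (μ : Measure Ω) [IsProbabilityMeasure μ]
    (X Y : Ω → ℝ) (hX : MemLp X 2 μ) (hY : MemLp Y 2 μ) (t : ℝ) :
    2 * t * cov[X, Y; μ] ≤ Var[X; μ] + t ^ 2 * Var[Y; μ] := by
  have h := variance_nonneg (X - t • Y) μ
  rw [variance_sub hX (hY.const_smul t), variance_smul, covariance_smul_right] at h
  linarith

theorem aux_memLp {Ω : Type*} [MeasurableSpace Ω] (μ : Measure Ω) [IsProbabilityMeasure μ]
    (S : Set Ω) (hS : MeasurableSet S) : MemLp (S.indicator (1 : Ω → ℝ)) 2 μ := by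
  exact memLp_indicator_const 2 hS (1 : ℝ) (Or.inr (measure_ne_top _ _))

open ProbabilityTheory in
theorem aux_var {Ω : Type*} [MeasurableSpace Ω] (μ : Measure Ω) [IsProbabilityMeasure μ]
    (S : Set Ω) (hS : MeasurableSet S) : Var[S.indicator (1 : Ω → ℝ); μ] ≤ 1 / 4 := by
  have := variance_le_sq_of_bounded (μ := μ) (a := 0) (b := 1) (X := S.indicator (1 : Ω → ℝ))
    (Filter.Eventually.of_forall fun x => by
      by_cases hx : x ∈ S <;> simp [hx]) (measurable_one.indicator hS).aemeasurable
  norm_num at this ⊢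
  exact this

section
variable {E : Type*} [NormedAddCommGroup E] [InnerProductSpace ℝ E] [FiniteDimensional ℝ E]

theorem aux_refl (V : Submodule ℝ E) (d : E) (hd : d ∈ V) (x : E) :
    V.starProjection ((ℝ ∙ d)ᗮ.reflection x) = (ℝ ∙ d)ᗮ.reflection (V.starProjection x) := by
  have h1 : (ℝ ∙ d)ᗮ.reflection (x - V.starProjection x) = x - V.starProjection x := by
    apply Submodule.reflection_mem_subspace_eq_self
    rw [Submodule.mem_orthogonal_singleton_iff_inner_right]
    exact (V.sub_starProjection_mem_orthogonal x) d hd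
  have h2 : (ℝ ∙ d)ᗮ.reflection (V.starProjection x) ∈ V := by
    rw [Submodule.reflection_orthogonal_apply, Submodule.reflection_singleton_apply]
    apply V.neg_mem
    apply V.sub_mem _ (by simp)
    exact V.smul_of_tower_mem _ (V.smul_mem _ hd)
  have h3 : (ℝ ∙ d)ᗮ.reflection x
      = (ℝ ∙ d)ᗮ.reflection (V.starProjection x) + (x - V.starProjection x) := by
    rw [← h1, ← map_add]; congr 1; abel
  rw [h3, map_add, Submodule.starProjection_eq_self_iff.2 h2,
    (Submodule.starProjection_apply_eq_zero_iff V).2 (V.sub_starProjection_mem_orthogonal x), add_zero]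

theorem aux_refl_fix (V : Submodule ℝ E) (d : E) (hd : d ∈ V) (x : E) (hx : x ∈ Vᗮ) :
    (ℝ ∙ d)ᗮ.reflection x = x := by
  apply Submodule.reflection_mem_subspace_eq_self
  rw [Submodule.mem_orthogonal_singleton_iff_inner_right]
  exact hx d hd

theorem aux_iso (V : Submodule ℝ E) (p p' q q' : E) (hp : p ∈ V) (hp' : p' ∈ V)
    (hq : q ∈ Vᗮ) (hq' : q' ∈ Vᗮ) (h1 : ‖p‖ = ‖p'‖) (h2 : ‖q‖ = ‖q'‖) :
    ∃ R : E ≃ₗᵢ[ℝ] E, R (p + q) = p' + q' ∧ ∀ x, ‖V.starProjection (R x)‖ = ‖V.starProjection x‖ := by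
  refine ⟨((ℝ ∙ (p - p'))ᗮ.reflection).trans ((ℝ ∙ (q - q'))ᗮ.reflection), ?_, ?_⟩
  · simp only [LinearIsometryEquiv.trans_apply, map_add]
    rw [Submodule.reflection_sub h1, aux_refl_fix V _ (V.sub_mem hp hp') q hq,
      Submodule.reflection_sub h2, aux_refl_fix Vᗮ _ (Vᗮ.sub_mem hq hq') p'
        (by simpa using hp')]
  · intro x
    simp only [LinearIsometryEquiv.trans_apply]
    have key : ∀ y, V.starProjection ((ℝ ∙ (q - q'))ᗮ.reflection y) = V.starProjection y := by
      intro y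
      have h := aux_refl Vᗮ _ (Vᗮ.sub_mem hq hq') y
      have h' : (ℝ ∙ (q - q'))ᗮ.reflection (V.starProjection y) = V.starProjection y :=
        aux_refl_fix Vᗮ _ (Vᗮ.sub_mem hq hq') _ (by simp)
      have e : ∀ z, V.starProjection z = z - Vᗮ.starProjection z := by
        intro z
        have := V.starProjection_add_starProjection_orthogonal z
        rw [eq_sub_iff_add_eq]; exact this
      rw [e, h, ← map_sub, ← e, h']
    rw [key, aux_refl V _ (V.sub_mem hp hp'), LinearIsometryEquiv.norm_map]

variable [MeasurableSpace E] [BorelSpace E]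

open ProbabilityTheory in
theorem aux_main (m : ℕ) (hm : 1 ≤ m) (V : Submodule ℝ E) (u w : Fin m → E)
    (hu : Orthonormal ℝ u) (hw : Orthonormal ℝ w) (huV : ∀ i, u i ∈ V) (hwV : ∀ i, w i ∈ Vᗮ)
    (a : E) (b c : ℝ) :
    cov[Set.indicator {x : E | inner ℝ a x ≤ b} 1,
      Set.indicator {x : E | ‖V.starProjection x‖ ^ 2 ≤ c} (1 : E → ℝ); stdGaussian E]
      ≤ 1 / Real.sqrt m := by
  set B := {x : E | ‖V.starProjection x‖ ^ 2 ≤ c} with hB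
  have hBm : MeasurableSet B :=
    measurableSet_le (by fun_prop) measurable_const
  have hAm : ∀ v : E, MeasurableSet {x : E | inner ℝ v x ≤ b} := fun v =>
    measurableSet_le (by fun_prop) measurable_const
  set p := V.starProjection a with hp
  set q := a - p with hq
  let a' : Fin m → E := fun i => ‖p‖ • u i + ‖q‖ • w i
  let F : Fin m → E → ℝ := fun i => Set.indicator {x : E | inner ℝ (a' i) x ≤ b} 1
  have hF : ∀ i, MemLp (F i) 2 (stdGaussian E) := fun i => aux_memLp _ _ (hAm _)
  have hG := aux_memLp (stdGaussian E) B hBm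
  have hqV : q ∈ Vᗮ := V.sub_starProjection_mem_orthogonal a
  have hpV : p ∈ V := by simp [hp]
  have hcov : ∀ i, cov[F i, B.indicator 1; stdGaussian E]
      = cov[Set.indicator {x : E | inner ℝ a x ≤ b} 1, B.indicator 1; stdGaussian E] := by
    intro i
    obtain ⟨R, hR1, hR2⟩ := aux_iso V p (‖p‖ • u i) q (‖q‖ • w i) hpV
      (V.smul_mem _ (huV i)) hqV (Vᗮ.smul_mem _ (hwV i))
      (by simp [norm_smul, hu.1 i]) (by simp [norm_smul, hw.1 i])
    have hpq : p + q = a := by simp [hq]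
    rw [hpq] at hR1
    conv_lhs => rw [← stdGaussian_map R]
    rw [covariance_map]
    · congr 1
      · ext x
        simp only [F, Function.comp, Set.indicator, Set.mem_setOf_eq, Pi.one_apply]
        have : inner ℝ (a' i) (R x) = inner ℝ a x := by
          change inner ℝ (‖p‖ • u i + ‖q‖ • w i) (R x) = _
          rw [← hR1, LinearIsometryEquiv.inner_map_map]
        rw [this]
      · ext x
        simp only [Function.comp, Set.indicator, hB, Set.mem_setOf_eq, Pi.one_apply, hR2]
    · exact (measurable_one.indicator (hAm _)).aestronglyMeasurable
    · exact (measurable_one.indicator hBm).aestronglyMeasurable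
    · exact R.continuous.measurable.aemeasurable
  have horth : ∀ i j, i ≠ j → inner ℝ (a' i) (a' j) = 0 := by
    intro i j hij
    have e1 : inner ℝ (u i) (w j) = 0 := hwV j _ (huV i)
    have e2 : inner ℝ (w i) (u j) = 0 := by
      rw [real_inner_comm]; exact hwV i _ (huV j)
    simp [a', inner_add_left, inner_add_right, inner_smul_left, inner_smul_right, e1, e2,
      hu.2 hij, hw.2 hij]
  have hind : ∀ i j, i ≠ j → IndepFun (F i) (F j) (stdGaussian E) := by
    intro i j hij
    have hl : HasGaussianLaw (fun x : E => ((inner ℝ (a' i) x : ℝ), (inner ℝ (a' j) x : ℝ)))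
        (stdGaussian E) :=
      (IsGaussian.hasGaussianLaw_id (μ := stdGaussian E)).map_fun
        ((innerSL ℝ (a' i)).prod (innerSL ℝ (a' j)))
    have h0 := hl.indepFun_of_covariance_eq_zero (by
      rw [← covarianceBilin_apply_eq_cov IsGaussian.memLp_two_id, covarianceBilin_stdGaussian,
        innerSL_apply_apply, horth i j hij])
    have hφ : Measurable (Set.indicator (Set.Iic b) (1 : ℝ → ℝ)) :=
      measurable_one.indicator measurableSet_Iic
    exact h0.comp hφ hφ
  have hvar : Var[∑ i, F i; stdGaussian E] ≤ m / 4 := by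
    rw [IndepFun.variance_sum (fun i _ => hF i) (fun i _ j _ hij => hind i j hij)]
    calc _ ≤ ∑ i : Fin m, (1 / 4 : ℝ) := Finset.sum_le_sum fun i _ => aux_var _ _ (hAm _)
      _ = m / 4 := by simp; ring
  have hS : MemLp (∑ i, F i) 2 (stdGaussian E) := memLp_finsetSum' _ fun i _ => hF i
  have hfin := aux_cov (stdGaussian E) _ _ hS hG (Real.sqrt m)
  rw [covariance_sum_left hF hG] at hfin
  simp only [hcov, Finset.sum_const, Finset.card_univ, Fintype.card_fin, nsmul_eq_mul] at hfin
  have hvG := aux_var (stdGaussian E) B hBm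
  have hm0 : (0 : ℝ) < m := by exact_mod_cast hm
  have hs := Real.sq_sqrt hm0.le
  have hs0 := Real.sqrt_pos.2 hm0
  rw [le_div_iff₀ hs0]
  rw [hs] at hfin
  generalize cov[Set.indicator {x : E | inner ℝ a x ≤ b} 1, B.indicator 1; stdGaussian E] = C at *
  have : (m : ℝ) * (C * √m) ≤ m * 1 := by nlinarith
  exact le_of_mul_le_mul_left this hm0

end

theorem aux_proj {E : Type*} [NormedAddCommGroup E] [InnerProductSpace ℝ E]
    [FiniteDimensional ℝ E] (m : ℕ) (u : Fin m → E) (hu : Orthonormal ℝ u) (x : E) :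
    ‖(Submodule.span ℝ (Set.range u)).starProjection x‖ ^ 2 = ∑ i, (inner ℝ (u i) x) ^ 2 := by
  have h : (Submodule.span ℝ (Set.range u)).starProjection x = ∑ i, (inner ℝ (u i) x : ℝ) • u i := by
    apply Submodule.eq_starProjection_of_mem_orthogonal
    · exact Submodule.sum_mem _ fun i _ => Submodule.smul_mem _ _ (Submodule.subset_span ⟨i, rfl⟩)
    · rw [Submodule.mem_orthogonal]
      intro v hv
      induction hv using Submodule.span_induction with
      | mem v hv =>
        obtain ⟨i, rfl⟩ := hv
        rw [inner_sub_right, hu.inner_right_fintype, sub_self]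
      | zero => simp
      | add a b _ _ ha hb => rw [inner_add_left, ha, hb, add_zero]
      | smul c a _ ha => rw [inner_smul_left, ha, mul_zero]
  rw [h, ← real_inner_self_eq_norm_sq, hu.inner_sum]
  simp [pow_two]

noncomputable def auxU (m : ℕ) (i : Fin m) : EuclideanSpace ℝ (Fin (m*m)) :=
  WithLp.toLp 2 fun j => if (j : ℕ) / m = (i : ℕ) then 1 / Real.sqrt m else 0

theorem auxU_inner (m : ℕ) (i : Fin m) (x : EuclideanSpace ℝ (Fin (m*m))) :
    inner ℝ (auxU m i) x =
      (∑ j : Fin (m*m), if (j : ℕ) / m = (i : ℕ) then x j else 0) / Real.sqrt m := by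
  rw [PiLp.inner_apply, Finset.sum_div]
  refine Finset.sum_congr rfl fun j _ => ?_
  simp only [auxU]
  split_ifs <;> simp [div_eq_mul_inv]

theorem auxU_orth (m : ℕ) (hm : 1 ≤ m) : Orthonormal ℝ (auxU m) := by
  rw [orthonormal_iff_ite]
  intro i k
  rw [auxU_inner, ← finProdFinEquiv.sum_comp, Fintype.sum_prod_type]
  have hm0 : (0 : ℝ) < m := by exact_mod_cast hm
  have hs := Real.mul_self_sqrt hm0.le
  have hs0 := Real.sqrt_pos.2 hm0
  have hd : ∀ x y : Fin m, ((finProdFinEquiv (x, y) : Fin (m*m)) : ℕ) / m = x := by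
    intro x y
    simp only [finProdFinEquiv_apply_val]
    rw [Nat.add_mul_div_left _ _ (by omega), Nat.div_eq_of_lt y.2, zero_add]
  simp only [auxU, hd, Fin.val_inj]
  simp only [Finset.sum_const, Finset.card_univ, Fintype.card_fin, nsmul_eq_mul]
  rw [Finset.sum_eq_single i (by intro x _ hx; simp [hx]) (by simp)]
  rw [if_pos rfl]
  by_cases h : i = k
  · rw [if_pos h, if_pos h]; field_simp; nlinarith
  · rw [if_neg h, if_neg h]; simp

open ProbabilityTheory in
theorem stmt19 (m : ℕ) (hm : 1 ≤ m) (A : Set (Fin (m*m) → ℝ))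
    (hA : IsHalfspace A) :
    gCov (m*m) (Set.indicator A 1)
      (Set.indicator {x : Fin (m*m) → ℝ | ∑ i : Fin m,
        ((∑ j : Fin (m*m), if (j : ℕ) / m = (i : ℕ) then x j else 0) / Real.sqrt m) ^ 2
          ≤ (m : ℝ)} 1) ≤ 1 / Real.sqrt m := by
  obtain ⟨a, b, rfl⟩ := hA
  set E := EuclideanSpace ℝ (Fin (m*m)) with hE
  set V := Submodule.span ℝ (Set.range (auxU m)) with hV
  have hu := auxU_orth m hm
  have hAm : MeasurableSet {x : E | inner ℝ (WithLp.toLp 2 a : E) x ≤ b} :=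
    measurableSet_le (by fun_prop) measurable_const
  have hBm : MeasurableSet {x : E | ‖V.starProjection x‖ ^ 2 ≤ (m : ℝ)} :=
    measurableSet_le (by fun_prop) measurable_const
  have main : cov[Set.indicator {x : E | inner ℝ (WithLp.toLp 2 a : E) x ≤ b} 1,
      Set.indicator {x : E | ‖V.starProjection x‖ ^ 2 ≤ (m : ℝ)} (1 : E → ℝ); stdGaussian E]
      ≤ 1 / Real.sqrt m := by
    rcases Nat.lt_or_ge 1 m with h2 | h2
    · have hfV : Module.finrank ℝ V = m := by
        rw [hV, finrank_span_eq_card hu.linearIndependent, Fintype.card_fin]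
      have hfin : m ≤ Module.finrank ℝ Vᗮ := by
        have h := V.finrank_add_finrank_orthogonal
        rw [hfV, finrank_euclideanSpace_fin] at h
        nlinarith
      refine aux_main m hm V (auxU m)
        (fun i => ((stdOrthonormalBasis ℝ Vᗮ) (Fin.castLE hfin i) : E)) hu ?_
        (fun i => Submodule.subset_span ⟨i, rfl⟩) (fun i => Subtype.property _) _ _ _
      exact ((stdOrthonormalBasis ℝ Vᗮ).orthonormal.comp _
        (Fin.castLE_injective hfin)).comp_linearIsometry Vᗮ.subtypeₗᵢ
    · obtain rfl : m = 1 := by omega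
      have h := aux_cov (stdGaussian E) _ _ (aux_memLp (stdGaussian E) _ hAm)
        (aux_memLp (stdGaussian E) _ hBm) 1
      have h1 := aux_var (stdGaussian E) _ hAm
      have h2 := aux_var (stdGaussian E) _ hBm
      simp only [Nat.cast_one, Real.sqrt_one] at *
      linarith
  refine le_of_eq_of_le ?_ main
  rw [← map_pi_eq_stdGaussian, covariance_map]
  · simp only [gCov, gExp, covariance, gauss]
    have e1 : (Set.indicator {x : E | inner ℝ (WithLp.toLp 2 a : E) x ≤ b} 1 : E → ℝ) ∘ WithLp.toLp 2
        = Set.indicator {x : Fin (m*m) → ℝ | ∑ i, x i * a i ≤ b} 1 := by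
      ext x
      simp [Set.indicator, PiLp.inner_apply]
    have e2 : (Set.indicator {x : E | ‖V.starProjection x‖ ^ 2 ≤ (m : ℝ)} 1 : E → ℝ) ∘ WithLp.toLp 2
        = Set.indicator {x : Fin (m*m) → ℝ | ∑ i : Fin m,
        ((∑ j : Fin (m*m), if (j : ℕ) / m = (i : ℕ) then x j else 0) / Real.sqrt m) ^ 2
          ≤ (m : ℝ)} 1 := by
      ext x
      simp only [Function.comp, Set.indicator, Set.mem_setOf_eq, hV, aux_proj m _ hu, auxU_inner,
        Pi.one_apply]
    rw [e1, e2]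
  · exact (measurable_one.indicator hAm).aestronglyMeasurable
  · exact (measurable_one.indicator hBm).aestronglyMeasurable
  · exact (by fun_prop : Measurable (WithLp.toLp 2)).aemeasurable
end
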